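/- arXiv:2211.15796 — 3 statements merged into one kernel-verified Lean document; each statement's English description precedes it below -/
import Mathlib

section
/- Let G be a simple graph of girth at least 5 such that R/I(G) is Cohen–Macaulay. Then the vertex cover ideal J(G) is weakly polymatroidal (in a suitable ordering of the variables). -/
/-!
STATEMENT 14: Let `G` be a simple graph of girth at least 5 such that `R/I(G)` is
Cohen–Macaulay.  Then the vertex cover ideal `J(G)` is weakly polymatroidal in a
suitable ordering of the variables.
-/
open MvPolynomial

namespace Stmt

variable (K : Type) [Field K]

/-- `F` is a vertex cover of the graph `G`. -/
def IsVertexCover {V : Type} (G : SimpleGraph V) (F : Finset V) : Prop :=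
  ∀ v w, G.Adj v w → v ∈ F ∨ w ∈ F

/-- `F` is a minimal vertex cover of the graph `G`. -/
def IsMinimalVertexCover {V : Type} (G : SimpleGraph V) (F : Finset V) : Prop :=
  IsVertexCover G F ∧ ∀ F' ⊆ F, IsVertexCover G F' → F' = F

/-- The vertex cover ideal `J(G)`, generated by the monomials `∏_{v ∈ F} x_v`
with `F` a minimal vertex cover of `G`. -/
noncomputable def coverIdeal {V : Type} (G : SimpleGraph V) : Ideal (MvPolynomial V K) :=
  Ideal.span { m | ∃ F : Finset V, IsMinimalVertexCover G F ∧ m = ∏ v ∈ F, X v }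

/-- The `s`-th symbolic power `J(G)^{(s)} = ⋂_{{v,w} ∈ E(G)} (x_v, x_w)^s`. -/
noncomputable def symbolicCoverPower {V : Type} (G : SimpleGraph V) (s : ℕ) :
    Ideal (MvPolynomial V K) :=
  ⨅ (v : V) (w : V) (_ : G.Adj v w), (Ideal.span {X v, X w} : Ideal (MvPolynomial V K)) ^ s

/-- `a` is the exponent vector of an element of the minimal monomial generating set `G(I)`
of the monomial ideal `I`: the monomial `x^a` lies in `I` and no proper monomial divisor
of it lies in `I`. -/
def IsMonoMinGen {τ : Type} (I : Ideal (MvPolynomial τ K)) (a : τ →₀ ℕ) : Prop :=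
  (monomial a (1 : K)) ∈ I ∧
    ∀ b : τ →₀ ℕ, (monomial b (1 : K)) ∈ I → b ≤ a → b = a

/-- A monomial ideal `I` (not necessarily generated in one degree) is weakly polymatroidal
with respect to a strict order `lt` on the variables (where `lt p q` means that the
variable `x_p` precedes, i.e. is greater than, the variable `x_q`):  for all exponent
vectors `a b` of minimal monomial generators `u = x^a`, `v = x^b` of `I`, if `a` and `b`
agree on all variables preceding `q` and `a q < b q`, then there is a variable `p`
coming after `q` such that `x_q · u / x_p` is again a minimal monomial generator. -/
def WeaklyPolymatroidalWrt {τ : Type} [DecidableEq τ] (lt : τ → τ → Prop)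
    (I : Ideal (MvPolynomial τ K)) : Prop :=
  ∀ a b : τ →₀ ℕ, IsMonoMinGen K I a → IsMonoMinGen K I b →
    ∀ q : τ, (∀ p, lt p q → a p = b p) → a q < b q →
      ∃ p, lt q p ∧ 0 < a p ∧
        IsMonoMinGen K I (a + Finsupp.single q 1 - Finsupp.single p 1)

/-- `G` is unmixed: all minimal vertex covers have the same cardinality. -/
def IsUnmixed {V : Type} (G : SimpleGraph V) : Prop :=
  ∀ F F' : Finset V, IsMinimalVertexCover G F → IsMinimalVertexCover G F' →
    F.card = F'.card

/-- A subgraph of `G` which is a cycle: it is connected and every one of its vertices has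
exactly two neighbours in it. -/
def IsCycleSubgraph {V : Type} (G : SimpleGraph V) (H : G.Subgraph) : Prop :=
  H.Connected ∧ ∀ v ∈ H.verts, (H.neighborSet v).ncard = 2

/-- `G` is a cactus graph: every edge of `G` belongs to at most one cycle. -/
def IsCactus {V : Type} (G : SimpleGraph V) : Prop :=
  ∀ C₁ C₂ : G.Subgraph, IsCycleSubgraph G C₁ → IsCycleSubgraph G C₂ →
    ∀ e ∈ C₁.edgeSet, e ∈ C₂.edgeSet → C₁ = C₂

/-- `G` is chordal: every cycle of length at least 4 has a chord. -/
def IsChordal {V : Type} (G : SimpleGraph V) : Prop :=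
  ∀ (v : V) (c : G.Walk v v), c.IsCycle → 4 ≤ c.length →
    ∃ a b, a ∈ c.support ∧ b ∈ c.support ∧ G.Adj a b ∧ s(a, b) ∉ c.edges

/-- The independence complex of `G`: faces are the independent sets of `G`. -/
def indepCpx {V : Type} (G : SimpleGraph V) : Finset V → Prop :=
  fun F => ∀ v ∈ F, ∀ w ∈ F, ¬ G.Adj v w

/-- The edge ideal `I(G)`, generated by the monomials `x_v x_w` over edges `{v,w}`. -/
noncomputable def edgeIdeal {V : Type} (G : SimpleGraph V) : Ideal (MvPolynomial V K) :=
  Ideal.span { m | ∃ v w, G.Adj v w ∧ m = X v * X w }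

/-- `R ⧸ I` is a Cohen–Macaulay ring, expressed (for a graded quotient of a polynomial
ring) by the existence of a regular sequence inside the graded maximal ideal
`m = (x_v : v)` whose length equals the Krull dimension of `R ⧸ I`
(i.e. `depth_m (R ⧸ I) = dim (R ⧸ I)`). -/
def IsCohenMacaulayQuot {τ : Type} (I : Ideal (MvPolynomial τ K)) : Prop :=
  ∃ rs : List (MvPolynomial τ K),
    (∀ r ∈ rs, r ∈ Ideal.span (Set.range (X : τ → MvPolynomial τ K))) ∧
    RingTheory.Sequence.IsRegular (MvPolynomial τ K ⧸ I) rs ∧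
    ((rs.length : WithTop ℕ) : WithBot (WithTop ℕ)) = ringKrullDim (MvPolynomial τ K ⧸ I)

section Koszul

variable {R M V : Type*} [CommRing R] [AddCommGroup M] [Module R M]

/-- The (non-alternating) Koszul differential `f ↦ η ∧ f` on cochains indexed by lists. -/
def wedge (η : V → R) : (List V → M) → List V → M
  | _, [] => 0
  | f, v :: l => η v • f l - wedge η (fun m => f (v :: m)) l
termination_by _ l => l.length

@[simp] lemma wedge_nil (η : V → R) (f : List V → M) : wedge η f [] = 0 := by
  rw [wedge]

@[simp] lemma wedge_cons (η : V → R) (f : List V → M) (v : V) (l : List V) :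
    wedge η f (v :: l) = η v • f l - wedge η (fun m => f (v :: m)) l := by
  rw [wedge]

lemma wedge_congr (η : V → R) {f g : List V → M} {l : List V}
    (h : ∀ m, m.length + 1 = l.length → f m = g m) : wedge η f l = wedge η g l := by
  induction l generalizing f g with
  | nil => simp
  | cons v l ih =>
    rw [wedge_cons, wedge_cons, h l (by simp), ih]
    intro m hm
    exact h _ (by simp [hm])

lemma wedge_map {N : Type*} [AddCommGroup N] [Module R N] (φ : M →ₗ[R] N) (η : V → R)
    (f : List V → M) (l : List V) : φ (wedge η f l) = wedge η (fun m => φ (f m)) l := by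
  induction l generalizing f with
  | nil => simp
  | cons v l ih => simp [ih]

lemma wedge_smul (η : V → R) (r : R) (f : List V → M) (l : List V) :
    wedge η (fun m => r • f m) l = r • wedge η f l := by
  induction l generalizing f with
  | nil => simp
  | cons v l ih => simp [ih, smul_sub, smul_comm r]

lemma wedge_add (η : V → R) (f g : List V → M) (l : List V) :
    wedge η (fun m => f m + g m) l = wedge η f l + wedge η g l := by
  induction l generalizing f g with
  | nil => simp
  | cons v l ih => simp only [wedge_cons, ih, smul_add]; abel

lemma wedge_sub (η : V → R) (f g : List V → M) (l : List V) :
    wedge η (fun m => f m - g m) l = wedge η f l - wedge η g l := by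
  induction l generalizing f g with
  | nil => simp
  | cons v l ih => simp only [wedge_cons, ih, smul_sub]; abel

lemma wedge_zero (η : V → R) (l : List V) : wedge η (fun _ => (0 : M)) l = 0 := by
  induction l with
  | nil => simp
  | cons v l ih => simp [ih]

lemma wedge_anticomm (η ζ : V → R) (f : List V → M) (l : List V) :
    wedge η (wedge ζ f) l = - wedge ζ (wedge η f) l := by
  induction l generalizing f with
  | nil => simp
  | cons v l ih =>
    simp only [wedge_cons, wedge_sub, wedge_smul, ih (fun m => f (v :: m))]
    abel

lemma wedge_self (η : V → R) (f : List V → M) (l : List V) :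
    wedge η (wedge η f) l = 0 := by
  induction l generalizing f with
  | nil => simp
  | cons v l ih => simp [wedge_sub, wedge_smul, ih]

lemma wedge_add_left (η ζ : V → R) (f : List V → M) (l : List V) :
    wedge (η + ζ) f l = wedge η f l + wedge ζ f l := by
  induction l generalizing f with
  | nil => simp
  | cons v l ih => simp only [wedge_cons, ih, Pi.add_apply, add_smul]; abel

lemma wedge_smul_left (r : R) (η : V → R) (f : List V → M) (l : List V) :
    wedge (r • η) f l = r • wedge η f l := by
  induction l generalizing f with
  | nil => simp
  | cons v l ih => simp [ih, smul_sub, mul_smul]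

lemma wedge_zero_left (f : List V → M) (l : List V) : wedge (0 : V → R) f l = 0 := by
  induction l generalizing f with
  | nil => simp
  | cons v l ih => simp [ih]

lemma wedge_sum_left {ι : Type*} (s : Finset ι) (η : ι → V → R) (f : List V → M) (l : List V) :
    wedge (∑ i ∈ s, η i) f l = ∑ i ∈ s, wedge (η i) f l := by
  classical
  induction s using Finset.induction_on with
  | empty => simp [wedge_zero_left]
  | insert a s ha ih => rw [Finset.sum_insert ha, Finset.sum_insert ha, wedge_add_left, ih]

/-- Exactness of the list Koszul complex in all degrees below `k`. -/
def KoszulExact (ξ : V → R) (M : Type*) [AddCommGroup M] [Module R M] (k : ℕ) : Prop :=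
  ∀ n < k, ∀ f : List V → M, (∀ l, l.length = n + 1 → wedge ξ f l = 0) →
    ∃ g, ∀ l, l.length = n → f l = wedge ξ g l

open scoped Pointwise in
lemma koszulExact_of_quotSMulTop (ξ : V → R) {r : R} (hr : IsSMulRegular M r) {k N : ℕ}
    (hN : r ^ N ∈ Ideal.span (Set.range ξ)) (hk : KoszulExact ξ (QuotSMulTop r M) k) :
    KoszulExact ξ M (k + 1) := by
  intro n hn f hf
  have cancel : ∀ (f : List V → M), (∃ g, ∀ l, l.length = n → r • f l = wedge ξ g l) →
      ∃ g, ∀ l, l.length = n → f l = wedge ξ g l := by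
    rintro f ⟨g, hg⟩
    obtain _ | m := n
    · refine ⟨fun _ => 0, fun l hl => hr ?_⟩
      obtain rfl := List.length_eq_zero_iff.mp hl
      simpa using hg [] rfl
    · let π := Submodule.mkQ (r • (⊤ : Submodule R M))
      obtain ⟨h, hh⟩ := hk m (by omega) (fun l => π (g l)) (fun l hl => by
        rw [← wedge_map, ← hg l hl]
        exact (Submodule.Quotient.mk_eq_zero _).mpr
          (Submodule.smul_mem_pointwise_smul _ _ _ trivial))
      choose h' hh' using fun l => Submodule.mkQ_surjective (r • (⊤ : Submodule R M)) (h l)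
      have key : ∀ l, ∃ x, l.length = m → g l - wedge ξ h' l = r • x := by
        intro l
        by_cases hl : l.length = m
        · have : π (g l - wedge ξ h' l) = 0 := by
            rw [map_sub, wedge_map]
            simp only [π, hh']
            rw [sub_eq_zero]
            exact hh l hl
          obtain ⟨x, -, hx⟩ := (Submodule.Quotient.mk_eq_zero _).mp this
          exact ⟨x, fun _ => hx.symm⟩
        · exact ⟨0, fun h => absurd h hl⟩
      choose g' hg' using key
      refine ⟨g', fun l hl => hr ?_⟩
      change r • f l = r • wedge ξ g' l
      rw [hg l hl, ← wedge_smul, ← sub_zero (wedge ξ g l), ← wedge_self ξ h' l, ← wedge_sub]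
      exact wedge_congr ξ fun m' hm' => hg' m' (by omega)
  have ideal : ∀ a ∈ Ideal.span (Set.range ξ),
      ∃ g, ∀ l, l.length = n → a • f l = wedge ξ g l := by
    intro a ha
    induction ha using Submodule.span_induction with
    | mem x hx =>
      obtain ⟨v, rfl⟩ := hx
      refine ⟨fun m => f (v :: m), fun l hl => ?_⟩
      have := hf (v :: l) (by simp [hl])
      rwa [wedge_cons, sub_eq_zero] at this
    | zero => exact ⟨fun _ => 0, fun l _ => by simp [wedge_zero]⟩
    | add x y _ _ hx hy =>
      obtain ⟨g, hg⟩ := hx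
      obtain ⟨g', hg'⟩ := hy
      exact ⟨fun m => g m + g' m, fun l hl => by rw [wedge_add, add_smul, hg l hl, hg' l hl]⟩
    | smul a x _ hx =>
      obtain ⟨g, hg⟩ := hx
      exact ⟨fun m => a • g m, fun l hl => by
        rw [wedge_smul, ← hg l hl, smul_eq_mul, mul_smul]⟩
  have iter : ∀ j, (∃ g, ∀ l, l.length = n → r ^ j • f l = wedge ξ g l) →
      ∃ g, ∀ l, l.length = n → f l = wedge ξ g l := by
    intro j
    induction j with
    | zero => simp
    | succ j ih =>
      rintro ⟨g, hg⟩
      exact ih (cancel (fun l => r ^ j • f l) ⟨g, fun l hl => by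
        rw [← hg l hl, pow_succ', mul_smul]⟩)
  exact iter N (ideal _ hN)

lemma koszulExact_of_isWeaklyRegular {R V : Type*} [CommRing R] (ξ : V → R) (rs : List R)
    {M : Type*} [AddCommGroup M] [Module R M]
    (hrs : ∀ r ∈ rs, ∃ N, r ^ N ∈ Ideal.span (Set.range ξ))
    (h : RingTheory.Sequence.IsWeaklyRegular M rs) : KoszulExact ξ M rs.length := by
  induction rs generalizing M with
  | nil => intro n hn; simp at hn
  | cons r rs ih =>
    rw [RingTheory.Sequence.isWeaklyRegular_cons_iff] at h
    obtain ⟨N, hN⟩ := hrs r (by simp)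
    exact koszulExact_of_quotSMulTop ξ h.1 hN
      (ih (fun s hs => hrs s (by simp [hs])) h.2)

lemma KoszulExact.lift {ξ : V → R} {I : Ideal R} {k : ℕ} (h : KoszulExact ξ (R ⧸ I) k)
    {n : ℕ} (hn : n < k) (f : List V → R)
    (hf : ∀ l, l.length = n + 1 → wedge ξ f l ∈ I) :
    ∃ g : List V → R, ∀ l, l.length = n → f l - wedge ξ g l ∈ I := by
  obtain ⟨g, hg⟩ := h n hn (fun l => I.mkQ (f l)) (fun l hl => by
    rw [← wedge_map]; exact (Submodule.Quotient.mk_eq_zero _).mpr (hf l hl))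
  choose g' hg' using fun l => Submodule.mkQ_surjective I (g l)
  refine ⟨g', fun l hl => ?_⟩
  rw [← Submodule.Quotient.mk_eq_zero, ← Submodule.mkQ_apply, map_sub, wedge_map, hg l hl,
    sub_eq_zero]
  simp only [hg']

lemma wedge_mem {I : Ideal R} (η : V → R) (h : List V → R) (hh : ∀ l, h l ∈ I) (l : List V) :
    wedge η h l ∈ I := by
  induction l generalizing h with
  | nil => simp
  | cons v l ih =>
    rw [wedge_cons]
    exact I.sub_mem (I.smul_mem _ (hh l)) (ih _ fun m => hh _)

lemma wedge_mem_of_left {I : Ideal R} {c : R} {η : V → R} (hη : ∀ v, c * η v ∈ I)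
    (h : List V → R) (l : List V) : c * wedge η h l ∈ I := by
  induction l generalizing h with
  | nil => simp
  | cons v l ih =>
    rw [wedge_cons, mul_sub, smul_eq_mul, ← mul_assoc]
    exact I.sub_mem (I.mul_mem_right _ (hη v)) (ih _)

lemma wedge_wedge_mem_of_left {I : Ideal R} {c : R} {η ζ : V → R}
    (hη : ∀ v w, c * η v * ζ w ∈ I) (h : List V → R) (l : List V) :
    c * wedge η (wedge ζ h) l ∈ I := by
  induction l generalizing h with
  | nil => simp
  | cons v l ih =>
    have h2 : c * ζ v * wedge η h l ∈ I :=
      wedge_mem_of_left (fun w => by rw [mul_right_comm]; exact hη w v) h l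
    have h1 : c * η v * wedge ζ h l ∈ I := wedge_mem_of_left (fun w => hη v w) h l
    have h3 := ih (fun m => h (v :: m))
    have hs : wedge η (fun m => ζ v * h m) l = ζ v * wedge η h l := wedge_smul η (ζ v) h l
    simp only [wedge_cons, wedge_sub, smul_eq_mul, hs]
    convert I.add_mem (I.sub_mem h1 h2) h3 using 1
    ring

/-- The indicator function of `u`. -/
def dirac (R : Type*) [CommRing R] [DecidableEq V] (u : V) : V → R := fun v => if v = u then 1 else 0

/-- `e_{v₁} ∧ ⋯ ∧ e_{vₖ} ∧ h` for the list `[v₁, …, vₖ]`. -/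
def wedgeList [DecidableEq V] (h : List V → R) : List V → List V → R
  | [] => h
  | v :: L => wedge (dirac R v) (wedgeList h L)

variable [DecidableEq V]

lemma wedge_dirac_notMem {v : V} {l : List V} (hv : v ∉ l) (h : List V → R) :
    wedge (dirac R v) h l = 0 := by
  induction l generalizing h with
  | nil => simp
  | cons u l ih =>
    rw [List.mem_cons, not_or] at hv
    simp [ih hv.2, dirac, Ne.symm hv.1]

lemma wedgeList_append (h : List V → R) (L t : List V) (hL : (L ++ t).Nodup) :
    wedgeList h L (L ++ t) = h t := by
  induction L with
  | nil => rfl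
  | cons v L ih =>
    rw [List.cons_append, List.nodup_cons] at hL
    rw [wedgeList, List.cons_append, wedge_cons, wedge_dirac_notMem hL.1, ih hL.2]
    simp [dirac]

lemma wedge_wedgeList (η : V → R) (h : List V → R) (L l : List V) :
    wedge η (wedgeList h L) l = (-1) ^ L.length * wedgeList (wedge η h) L l := by
  induction L generalizing l with
  | nil => simp [wedgeList]
  | cons v L ih =>
    rw [wedgeList, wedge_anticomm, wedge_congr _ (fun m _ => ih m)]
    simp only [← smul_eq_mul]
    rw [wedge_smul, wedgeList, List.length_cons, pow_succ]
    simp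

lemma wedgeList_smul (c : R) (h : List V → R) (L l : List V) :
    wedgeList (fun m => c * h m) L l = c * wedgeList h L l := by
  induction L generalizing l with
  | nil => rfl
  | cons v L ih =>
    rw [wedgeList, wedgeList, wedge_congr _ (fun m _ => ih m), ← smul_eq_mul, ← wedge_smul]
    rfl

lemma wedgeList_mem {I : Ideal R} (h : List V → R) (hh : ∀ l, h l ∈ I) (L l : List V) :
    wedgeList h L l ∈ I := by
  induction L generalizing l with
  | nil => exact hh l
  | cons v L ih => exact wedge_mem _ _ ih l

lemma wedge_dirac_wedgeList_mem (h : List V → R) {u : V} {L : List V} (hu : u ∈ L)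
    (l : List V) : wedge (dirac R u) (wedgeList h L) l = 0 := by
  induction L generalizing l with
  | nil => simp at hu
  | cons v L ih =>
    by_cases huv : u = v
    · subst huv
      exact wedge_self _ _ _
    · have hu' : u ∈ L := by simpa [huv] using hu
      rw [wedgeList, wedge_anticomm, wedge_congr _ (fun m _ => ih hu' m), wedge_zero, neg_zero]

lemma eq_sum_dirac [Fintype V] (ξ : V → R) : ξ = ∑ v, ξ v • dirac R v := by
  ext u
  simp [dirac, Finset.sum_apply]

end Koszul

section EdgeIdeal

/-- `S` is a maximal independent set of `H`. -/
def MaxIndep {V : Type} (H : SimpleGraph V) (S : Finset V) : Prop :=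
  indepCpx H S ∧ ∀ v, v ∉ S → ∃ s ∈ S, H.Adj v s

variable {K : Type} [Field K] {V : Type} {G : SimpleGraph V}

lemma mul_mem_edgeIdeal {u v : V} (h : G.Adj u v) {p : MvPolynomial V K}
    (hp : X u * X v ∣ p) : p ∈ edgeIdeal K G :=
  Ideal.mem_of_dvd _ hp (Ideal.subset_span ⟨u, v, h, rfl⟩)

lemma coeff_eq_zero_of_mem_edgeIdeal {p : MvPolynomial V K} (hp : p ∈ edgeIdeal K G)
    (m : V →₀ ℕ) (hm : ∀ v w, G.Adj v w → m v = 0 ∨ m w = 0) : coeff m p = 0 := by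
  classical
  induction hp using Submodule.span_induction generalizing m with
  | mem x hx =>
    obtain ⟨v, w, h, rfl⟩ := hx
    rw [X, X, monomial_mul, coeff_monomial, if_neg]
    rintro rfl
    have := hm v w h
    simp at this
  | zero => simp
  | add x y _ _ hx hy => rw [coeff_add, hx m hm, hy m hm, add_zero]
  | smul a x _ hx =>
    rw [smul_eq_mul, coeff_mul]
    refine Finset.sum_eq_zero fun ij hij => ?_
    rw [Finset.HasAntidiagonal.mem_antidiagonal] at hij
    rw [hx, mul_zero]
    intro v w h
    have h1 := DFunLike.congr_fun hij v
    have h2 := DFunLike.congr_fun hij w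
    simp only [Finsupp.add_apply] at h1 h2
    have := hm v w h
    omega

lemma card_le_of_indep [Fintype V] {F : Finset V} (hF : indepCpx G F) :
    (F.card : WithBot (WithTop ℕ)) ≤ ringKrullDim (MvPolynomial V K ⧸ edgeIdeal K G) := by
  classical
  let φ : MvPolynomial V K →ₐ[K] MvPolynomial F K :=
    aeval fun v => if h : v ∈ F then X ⟨v, h⟩ else 0
  have hφ : ∀ a ∈ edgeIdeal K G, φ.toRingHom a = 0 := by
    have : edgeIdeal K G ≤ RingHom.ker φ.toRingHom := by
      refine Ideal.span_le.mpr ?_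
      rintro _ ⟨v, w, h, rfl⟩
      simp only [SetLike.mem_coe, RingHom.mem_ker, AlgHom.toRingHom_eq_coe, RingHom.coe_coe, map_mul,
        φ, aeval_X]
      by_cases hv : v ∈ F
      · have hw : w ∉ F := fun hw => hF v hv w hw h
        simp [hw]
      · simp [hv]
    exact fun a ha => this ha
  have hs : Function.Surjective φ := by
    intro q
    refine ⟨rename Subtype.val q, ?_⟩
    simp only [φ, aeval_rename]
    convert aeval_X_left_apply q using 2
    congr 1
    ext i
    simp
  have := ringKrullDim_le_of_surjective (Ideal.Quotient.lift _ φ.toRingHom hφ)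
    (Ideal.Quotient.lift_surjective_of_surjective _ hφ hs)
  rw [MvPolynomial.ringKrullDim_of_isNoetherianRing, ringKrullDim_eq_zero_of_field, zero_add,
    Nat.card_eq_fintype_card, Fintype.card_coe] at this
  exact this

/-- The combinatorial content of the Cohen–Macaulay property that is used: a bound on the
size of faces and exactness of the list Koszul complex on the squares of the variables. -/
structure KoszulCM (K : Type) [Field K] {V : Type} (G : SimpleGraph V) (d : ℕ) : Prop where
  card_le : ∀ F : Finset V, indepCpx G F → F.card ≤ d
  exact : KoszulExact (fun v => (X v : MvPolynomial V K) ^ 2)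
    (MvPolynomial V K ⧸ edgeIdeal K G) d

lemma exists_koszulCM [Fintype V] (h : IsCohenMacaulayQuot K (edgeIdeal K G)) :
    ∃ d, KoszulCM K G d := by
  obtain ⟨rs, hmem, hreg, hdim⟩ := h
  refine ⟨rs.length, ⟨fun F hF => ?_, ?_⟩⟩
  · have := card_le_of_indep (K := K) hF
    rw [← hdim] at this
    exact_mod_cast this
  · refine koszulExact_of_isWeaklyRegular _ rs (fun r hr => ?_) hreg.toIsWeaklyRegular
    have : Ideal.span (Set.range (X : V → MvPolynomial V K)) ≤
        (Ideal.span (Set.range fun v => (X v : MvPolynomial V K) ^ 2)).radical := by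
      refine Ideal.span_le.mpr ?_
      rintro _ ⟨v, rfl⟩
      exact ⟨2, Ideal.subset_span ⟨v, rfl⟩⟩
    exact this (hmem r hr)

lemma coeff_wedge_append {ξ : V → MvPolynomial V K} {m : V →₀ ℕ} (g : List V → MvPolynomial V K)
    (L t : List V) (hL : ∀ v ∈ L, ∀ p, coeff m (ξ v * p) = 0) :
    coeff m (wedge ξ g (L ++ t)) =
      (-1) ^ L.length * coeff m (wedge ξ (fun s => g (L ++ s)) t) := by
  induction L generalizing g with
  | nil => simp
  | cons v L ih =>
    rw [List.cons_append, wedge_cons, coeff_sub, smul_eq_mul, hL v (by simp), zero_sub,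
      ih _ (fun u hu => hL u (by simp [hu])), List.length_cons, pow_succ]
    simp

lemma coeff_X_sq_mul [DecidableEq V] (v : V) (m : V →₀ ℕ) (p : MvPolynomial V K) :
    coeff m (X v ^ 2 * p) = if 2 ≤ m v then coeff (m - Finsupp.single v 2) p else 0 := by
  rw [X_pow_eq_monomial, coeff_monomial_mul']
  simp [Finsupp.single_le_iff]

/-- The exponent vector of `∏_{v ∈ F} x_v`. -/
noncomputable def expOf (F : Finset V) : V →₀ ℕ := ∑ v ∈ F, Finsupp.single v 1

lemma expOf_apply [DecidableEq V] (F : Finset V) (v : V) :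
    expOf F v = if v ∈ F then 1 else 0 := by
  simp [expOf, Finsupp.finsetSum_apply, Finsupp.single_apply]

lemma X_dvd_monomial_expOf {F : Finset V} {v : V} (hv : v ∈ F) :
    (X v : MvPolynomial V K) ∣ monomial (expOf F) 1 := by
  classical
  refine ⟨monomial (expOf F - Finsupp.single v 1) 1, ?_⟩
  rw [X, monomial_mul, mul_one]
  congr 1
  rw [add_tsub_cancel_of_le]
  simp [Finsupp.single_le_iff, expOf_apply, hv]

lemma sq_mul_monomial_mem {F : Finset V} {u v : V} (hv : v ∈ F) (h : G.Adj u v) :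
    (X u : MvPolynomial V K) ^ 2 * monomial (expOf F) 1 ∈ edgeIdeal K G :=
  mul_mem_edgeIdeal h (mul_dvd_mul (dvd_pow_self _ two_ne_zero) (X_dvd_monomial_expOf hv))

lemma KoszulCM.card_eq [Fintype V] {d : ℕ} (h : KoszulCM K G d)
    {F : Finset V} (hF : MaxIndep G F) : F.card = d := by
  classical
  refine (h.card_le F hF.1).antisymm (not_lt.mp fun hlt => ?_)
  let L := F.toList
  let xF : MvPolynomial V K := monomial (expOf F) 1
  let one : List V → MvPolynomial V K := fun l => if l = [] then 1 else 0
  obtain ⟨g, hg⟩ := h.exact.lift hlt (fun l => xF * wedgeList one L l) (by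
    intro l _
    have e : wedge (fun v => (X v : MvPolynomial V K) ^ 2) (fun l => xF * wedgeList one L l) l =
        ∑ v, X v ^ 2 * xF * wedge (dirac (MvPolynomial V K) v) (wedgeList one L) l := by
      conv_lhs => rw [eq_sum_dirac fun v => (X v : MvPolynomial V K) ^ 2]
      rw [wedge_sum_left]
      refine Finset.sum_congr rfl fun v _ => ?_
      rw [wedge_smul_left, mul_assoc]
      congr 1
      exact wedge_smul _ xF _ l
    rw [e]
    refine Ideal.sum_mem _ fun v _ => ?_
    by_cases hv : v ∈ F
    · rw [wedge_dirac_wedgeList_mem _ (Finset.mem_toList.mpr hv), mul_zero]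
      exact Ideal.zero_mem _
    · obtain ⟨s, hs, hvs⟩ := hF.2 v hv
      exact Ideal.mul_mem_right _ _ (sq_mul_monomial_mem hs hvs))
  have h1 := coeff_eq_zero_of_mem_edgeIdeal (hg L (by simp [L])) (expOf F) (by
    intro v w hvw
    by_contra! hne
    simp only [expOf_apply, ne_eq, ite_eq_right_iff, one_ne_zero, imp_false, not_not] at hne
    exact hF.1 v hne.1 w hne.2 hvw)
  have h2 : wedgeList one L L = 1 := by
    have := wedgeList_append one L [] (by simpa using F.nodup_toList)
    simpa [one] using this
  have h3 := coeff_wedge_append (ξ := fun v => (X v : MvPolynomial V K) ^ 2) (m := expOf F) g L []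
    (by
      intro v _ p
      rw [coeff_X_sq_mul, if_neg]
      rw [expOf_apply]; split_ifs <;> simp)
  rw [coeff_sub, h2, mul_one] at h1
  simp only [List.append_nil, wedge_nil, coeff_zero, mul_zero] at h3
  rw [h3, coeff_monomial] at h1
  simp at h1

lemma indepCpx.insert [DecidableEq V] {T : Finset V} {c : V} (hT : indepCpx G T)
    (hc : ∀ t ∈ T, ¬ G.Adj c t) : indepCpx G (insert c T) := by
  intro v hv w hw hvw
  rcases Finset.mem_insert.mp hv with hv' | hv' <;>
    rcases Finset.mem_insert.mp hw with hw' | hw'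
  · exact G.irrefl ((hv'.trans hw'.symm) ▸ hvw)
  · exact hc w hw' (hv' ▸ hvw)
  · exact hc v hv' (hw' ▸ hvw.symm)
  · exact hT v hv' w hw' hvw

lemma KoszulCM.no_heptagon [Fintype V] [DecidableEq V] {d : ℕ} (h : KoszulCM K G d)
    {T : Finset V} (hT : indepCpx G T) {c₀ c₁ c₂ c₃ c₄ c₅ c₆ : V}
    (hnodup : [c₀, c₁, c₂, c₃, c₄, c₅, c₆].Nodup)
    (h01 : G.Adj c₀ c₁) (h12 : G.Adj c₁ c₂) (h23 : G.Adj c₂ c₃) (h34 : G.Adj c₃ c₄)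
    (h45 : G.Adj c₄ c₅) (h56 : G.Adj c₅ c₆) (h60 : G.Adj c₆ c₀)
    (n16 : ¬ G.Adj c₁ c₆) (n15 : ¬ G.Adj c₁ c₅) (n26 : ¬ G.Adj c₂ c₆) (n25 : ¬ G.Adj c₂ c₅)
    (n02 : ¬ G.Adj c₀ c₂) (n04 : ¬ G.Adj c₀ c₄) (n24 : ¬ G.Adj c₂ c₄)
    (hcT : ∀ c ∈ [c₀, c₁, c₂, c₃, c₄, c₅, c₆], c ∉ T ∧ ∀ t ∈ T, ¬ G.Adj c t)
    (hdom : ∀ u, u ∉ T → u ∉ [c₀, c₁, c₂, c₃, c₄, c₅, c₆] → ∃ t ∈ T, G.Adj u t) :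
    False := by
  have hn := hnodup
  simp only [List.nodup_cons, List.mem_cons, not_or, List.not_mem_nil, not_false_eq_true,
    and_true] at hn
  obtain ⟨⟨h0_1, h0_2, h0_3, h0_4, h0_5, h0_6⟩, ⟨h1_2, h1_3, h1_4, h1_5, h1_6⟩,
    ⟨h2_3, h2_4, h2_5, h2_6⟩, ⟨h3_4, h3_5, h3_6⟩, ⟨h4_5, h4_6⟩, h5_6, -⟩ := hn
  have hlt : T.card + 2 < d := by
    have hind : indepCpx G (insert c₀ (insert c₂ (insert c₄ T))) := by
      refine (hT.insert (hcT c₄ (by simp)).2).insert ?_ |>.insert ?_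
      · intro t ht
        rcases Finset.mem_insert.mp ht with rfl | ht
        exacts [n24, (hcT c₂ (by simp)).2 t ht]
      · intro t ht
        rcases Finset.mem_insert.mp ht with rfl | ht
        · exact n02
        rcases Finset.mem_insert.mp ht with rfl | ht
        exacts [n04, (hcT c₀ (by simp)).2 t ht]
    have := h.card_le _ hind
    have m0 := (hcT c₀ (by simp)).1
    have m2 := (hcT c₂ (by simp)).1
    have m4 := (hcT c₄ (by simp)).1
    rw [Finset.card_insert_of_notMem (by simp [h0_2, h0_4, m0]),
      Finset.card_insert_of_notMem (by simp [h2_4, m2]),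
      Finset.card_insert_of_notMem m4] at this
    omega
  let L := T.toList
  have hLlen : L.length = T.card := by simp [L]
  let P := MvPolynomial V K
  let ξ : V → P := fun v => X v ^ 2
  let xT : P := monomial (expOf T) 1
  let one : List V → P := fun l => if l = [] then 1 else 0
  let A : V → P := ξ c₁ • dirac P c₁ + ξ c₃ • dirac P c₃
  let B : V → P := ξ c₄ • dirac P c₄ + ξ c₆ • dirac P c₆
  let η : List V → P := wedge A (wedge B one)
  have zeroList : ∀ (η : List V → P), (∀ l, η l = 0) → ∀ l, wedgeList η L l = 0 := by
    intro η hη l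
    have := wedgeList_mem (I := (⊥ : Ideal P)) η (fun l => by simp [hη l]) L l
    simpa using this
  have hAη : ∀ l, wedge A (wedgeList η L) l = 0 := fun l => by
    rw [wedge_wedgeList, zeroList _ (fun l => wedge_self A _ l), mul_zero]
  have hBη : ∀ l, wedge B (wedgeList η L) l = 0 := fun l => by
    rw [wedge_wedgeList, zeroList _ (fun l => ?_), mul_zero]
    rw [wedge_anticomm, wedge_congr A (fun m _ => wedge_self B one m), wedge_zero, neg_zero]
  have hmid : ∀ u, (∀ a ∈ [c₁, c₃], ∀ b ∈ [c₄, c₆], G.Adj u a ∨ G.Adj u b ∨ G.Adj a b) →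
      ∀ l, ξ u * wedgeList η L l ∈ edgeIdeal K G := by
    intro u hu l
    have hmem : ∀ a ∈ [c₁, c₃], ∀ b ∈ [c₄, c₆], ξ u * ξ a * ξ b ∈ edgeIdeal K G := by
      intro a ha b hb
      change (X u : MvPolynomial V K) ^ 2 * X a ^ 2 * X b ^ 2 ∈ _
      rcases hu a ha b hb with h | h | h
      · exact mul_mem_edgeIdeal h ⟨X u * X a * X b ^ 2, by ring⟩
      · exact mul_mem_edgeIdeal h ⟨X u * X a ^ 2 * X b, by ring⟩
      · exact mul_mem_edgeIdeal h ⟨X u ^ 2 * X a * X b, by ring⟩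
    rw [← wedgeList_smul]
    refine wedgeList_mem _ (fun l => ?_) L l
    refine wedge_wedge_mem_of_left (fun v w => ?_) one l
    have e : ξ u * A v * B w = dirac P c₁ v * dirac P c₄ w * (ξ u * ξ c₁ * ξ c₄) +
        dirac P c₁ v * dirac P c₆ w * (ξ u * ξ c₁ * ξ c₆) +
        (dirac P c₃ v * dirac P c₄ w * (ξ u * ξ c₃ * ξ c₄) +
        dirac P c₃ v * dirac P c₆ w * (ξ u * ξ c₃ * ξ c₆)) := by
      simp only [A, B, Pi.add_apply, Pi.smul_apply, smul_eq_mul]; ring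
    rw [e]
    refine Ideal.add_mem _ (Ideal.add_mem _ ?_ ?_) (Ideal.add_mem _ ?_ ?_) <;>
      exact Ideal.mul_mem_left _ _ (hmem _ (by simp) _ (by simp))
  have hξ : ξ = A + B + ∑ u ∈ Finset.univ \ {c₁, c₃, c₄, c₆}, ξ u • dirac P u := by
    conv_lhs => rw [eq_sum_dirac ξ]
    rw [← Finset.sum_sdiff (Finset.subset_univ {c₁, c₃, c₄, c₆}), add_comm]
    congr 1
    rw [Finset.sum_insert (by simp [h1_3, h1_4, h1_6]), Finset.sum_insert (by simp [h3_4, h3_6]),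
      Finset.sum_insert (by simp [h4_6]), Finset.sum_singleton, ← add_assoc]
  obtain ⟨g, hg⟩ := h.exact.lift hlt (fun l => xT * wedgeList η L l) (by
    intro l _
    change wedge ξ _ l ∈ _
    have e0 : wedge ξ (fun l => xT * wedgeList η L l) l = xT * wedge ξ (wedgeList η L) l :=
      wedge_smul _ xT _ l
    rw [e0, hξ, wedge_add_left, wedge_add_left, hAη, hBη, zero_add, zero_add, wedge_sum_left,
      Finset.mul_sum]
    refine Ideal.sum_mem _ fun u hu => ?_
    have e1 : xT * wedge (ξ u • dirac P u) (wedgeList η L) l =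
        xT * wedge (dirac P u) (fun l => ξ u * wedgeList η L l) l := by
      rw [wedge_smul_left]
      congr 1
      exact (wedge_smul _ (ξ u) _ l).symm
    by_cases huT : u ∈ T
    · rw [wedge_smul_left, wedge_dirac_wedgeList_mem _ (Finset.mem_toList.mpr huT), smul_zero,
        mul_zero]
      exact Ideal.zero_mem _
    by_cases huc : u ∈ [c₀, c₁, c₂, c₃, c₄, c₅, c₆]
    · rw [e1]
      refine Ideal.mul_mem_left _ _ (wedge_mem _ _ (hmid u ?_) l)
      simp only [List.mem_cons, List.not_mem_nil, or_false] at huc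
      simp only [Finset.mem_sdiff, Finset.mem_univ, true_and, Finset.mem_insert,
        Finset.mem_singleton, not_or] at hu
      obtain ⟨hu1, hu3, hu4, hu6⟩ := hu
      simp only [hu1, hu3, hu4, hu6, false_or, or_false] at huc
      simp only [List.mem_cons, List.not_mem_nil, or_false, forall_eq_or_imp, forall_eq]
      rcases huc with rfl | rfl | rfl
      · exact ⟨⟨.inl h01, .inl h01⟩, .inr (.inr h34), .inr (.inl h60.symm)⟩
      · exact ⟨⟨.inl h12.symm, .inl h12.symm⟩, .inl h23, .inl h23⟩
      · exact ⟨⟨.inr (.inl h45.symm), .inr (.inl h56)⟩, .inr (.inl h45.symm), .inr (.inl h56)⟩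
    · obtain ⟨t, ht, hut⟩ := hdom u huT huc
      rw [wedge_smul_left, smul_eq_mul, ← mul_assoc, mul_comm xT]
      exact Ideal.mul_mem_right _ _ (sq_mul_monomial_mem ht hut))
  let γ : V → K := fun v => coeff (expOf T + Finsupp.single v 2) (g (L ++ [v]))
  have key : ∀ p ∈ [c₀, c₁, c₂, c₃, c₄, c₅, c₆], ∀ q ∈ [c₀, c₁, c₂, c₃, c₄, c₅, c₆], p ≠ q →
      ¬ G.Adj p q → coeff (expOf T + Finsupp.single p 2 + Finsupp.single q 2)
        (xT * (A p * B q - A q * B p)) = (-1) ^ L.length * (γ q - γ p) := by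
    intro p hp q hq hpq hadj
    obtain ⟨hpT, hpa⟩ := hcT p hp
    obtain ⟨hqT, hqa⟩ := hcT q hq
    set m := expOf T + Finsupp.single p 2 + Finsupp.single q 2 with hm
    have hmv : ∀ v, m v = (if v ∈ T then 1 else 0) + (if p = v then 2 else 0) +
        (if q = v then 2 else 0) := by
      intro v
      simp [m, expOf_apply, Finsupp.single_apply]
    have h1 := coeff_eq_zero_of_mem_edgeIdeal (hg (L ++ [p, q]) (by simp [hLlen])) m (by
      intro v w hvw
      by_contra! hne
      have hin : ∀ v, m v ≠ 0 → v ∈ T ∨ v = p ∨ v = q := by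
        intro v hv
        by_contra! hcon
        apply hv
        rw [hmv, if_neg hcon.1, if_neg hcon.2.1.symm, if_neg hcon.2.2.symm]
      rcases hin v hne.1 with hv | rfl | rfl <;> rcases hin w hne.2 with hw | rfl | rfl
      · exact hT v hv w hw hvw
      · exact hpa v hv hvw.symm
      · exact hqa v hv hvw.symm
      · exact hpa w hw hvw
      · exact G.irrefl hvw
      · exact hadj hvw
      · exact hqa w hw hvw
      · exact hadj hvw.symm
      · exact G.irrefl hvw)
    have h2 : wedgeList η L (L ++ [p, q]) = A p * B q - A q * B p := by
      rw [wedgeList_append]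
      · simp [η, one]
      · rw [List.nodup_append]
        refine ⟨T.nodup_toList, by simpa using hpq, ?_⟩
        simp only [List.mem_cons, List.not_mem_nil, or_false, L, Finset.mem_toList]
        rintro a ha b (rfl | rfl) rfl
        · exact hpT ha
        · exact hqT ha
    have h3 := coeff_wedge_append (ξ := ξ) (m := m) g L [p, q] (by
      intro v hv r
      have hv : v ∈ T := Finset.mem_toList.mp hv
      rw [coeff_X_sq_mul, if_neg]
      rw [hmv, if_pos hv, if_neg (by rintro rfl; exact hpT hv),
        if_neg (by rintro rfl; exact hqT hv)]
      simp)
    rw [coeff_sub, h2, sub_eq_zero] at h1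
    rw [h1]
    refine h3.trans ?_
    congr 1
    simp only [wedge_cons, wedge_nil, sub_zero, smul_eq_mul, coeff_sub, ξ]
    rw [coeff_X_sq_mul, coeff_X_sq_mul, if_pos, if_pos]
    · simp only [γ, m]
      rw [add_tsub_cancel_right, add_right_comm, add_tsub_cancel_right]
    · rw [hmv, if_pos (rfl : q = q)]; omega
    · rw [hmv, if_pos (rfl : p = p)]; omega
  have A1 : A c₁ = ξ c₁ := by simp [A, dirac, h1_3]
  have A2 : A c₂ = 0 := by simp [A, dirac, Ne.symm h1_2, h2_3]
  have A5 : A c₅ = 0 := by simp [A, dirac, Ne.symm h1_5, Ne.symm h3_5]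
  have A6 : A c₆ = 0 := by simp [A, dirac, Ne.symm h1_6, Ne.symm h3_6]
  have B5 : B c₅ = 0 := by simp [B, dirac, Ne.symm h4_5, h5_6]
  have B6 : B c₆ = ξ c₆ := by simp [B, dirac, Ne.symm h4_6]
  have k15 := key c₁ (by simp) c₅ (by simp) h1_5 n15
  have k25 := key c₂ (by simp) c₅ (by simp) h2_5 n25
  have k26 := key c₂ (by simp) c₆ (by simp) h2_6 n26
  have k16 := key c₁ (by simp) c₆ (by simp) h1_6 n16
  have hneg : ((-1 : K)) ^ L.length ≠ 0 := pow_ne_zero _ (by simp)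
  rw [A1, A5, B5] at k15
  rw [A2, A5] at k25
  rw [A2, A6] at k26
  rw [A1, A6, B6] at k16
  simp only [mul_zero, zero_mul, sub_zero, coeff_zero, zero_eq_mul, hneg, false_or] at k15 k25 k26
  have z : γ c₆ - γ c₁ = 0 := by linear_combination k26 - k25 + k15
  rw [z, mul_zero] at k16
  rw [zero_mul, sub_zero] at k16
  change coeff _ (monomial (expOf T) (1 : K) * (X c₁ ^ 2 * X c₆ ^ 2)) = 0 at k16
  rw [X_pow_eq_monomial, X_pow_eq_monomial, monomial_mul, monomial_mul, coeff_monomial,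
    ← add_assoc, if_pos rfl] at k16
  simp at k16

end EdgeIdeal

section Structure
variable {V : Type} {H : SimpleGraph V}

/-- `H` has no cycles of length three or four. -/
structure GirthFive (H : SimpleGraph V) : Prop where
  tri : ∀ a b c, H.Adj a b → H.Adj b c → H.Adj c a → False
  sq : ∀ a b c d, H.Adj a b → H.Adj b c → H.Adj c d → H.Adj d a → a = c ∨ b = d

/-- All maximal independent sets of `H` have the same size. -/
def WellCovered (H : SimpleGraph V) : Prop := ∃ k, ∀ S, MaxIndep H S → S.card = k

/-- All neighbours of `a` are among `e` and `b`. -/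
def Sm (H : SimpleGraph V) (e a b : V) : Prop := ∀ y, H.Adj a y → y = e ∨ y = b

lemma Sm.symm {e a b : V} (h : Sm H e a b) : Sm H b a e := fun y hy => (h y hy).symm

/-- The neighbourhood of `x` is exactly `{a, b}`, with `a ≠ b`. -/
structure DegTwo (H : SimpleGraph V) (x a b : V) : Prop where
  ne : a ≠ b
  left : H.Adj x a
  right : H.Adj x b
  sm : Sm H a x b

lemma DegTwo.symm {x a b : V} (h : DegTwo H x a b) : DegTwo H x b a :=
  ⟨h.ne.symm, h.right, h.left, h.sm.symm⟩

/-- `b` is a leaf with stem `a`. -/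
structure Leaf (H : SimpleGraph V) (b a : V) : Prop where
  adj : H.Adj b a
  only : ∀ y, H.Adj b y → y = a

/-- `a, b, c, d, e` is a basic five-cycle: no two consecutive vertices have outer neighbours. -/
structure Bas (H : SimpleGraph V) (a b c d e : V) : Prop where
  ab : H.Adj a b
  bc : H.Adj b c
  cd : H.Adj c d
  de : H.Adj d e
  ea : H.Adj e a
  sab : Sm H e a b ∨ Sm H a b c
  sbc : Sm H a b c ∨ Sm H b c d
  scd : Sm H b c d ∨ Sm H c d e
  sde : Sm H c d e ∨ Sm H d e a
  sea : Sm H d e a ∨ Sm H e a b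

variable {a b c d e : V}

lemma Bas.rot (h : Bas H a b c d e) : Bas H b c d e a :=
  ⟨h.bc, h.cd, h.de, h.ea, h.ab, h.sbc, h.scd, h.sde, h.sea, h.sab⟩

lemma Bas.refl (h : Bas H a b c d e) : Bas H a e d c b :=
  ⟨h.ea.symm, h.de.symm, h.cd.symm, h.bc.symm, h.ab.symm,
    h.sea.symm.imp Sm.symm Sm.symm, h.sde.symm.imp Sm.symm Sm.symm,
    h.scd.symm.imp Sm.symm Sm.symm, h.sbc.symm.imp Sm.symm Sm.symm,
    h.sab.symm.imp Sm.symm Sm.symm⟩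

/-- `x` is isolated, belongs to a pendant edge, or lies on a basic five-cycle. -/
def Good (H : SimpleGraph V) (x : V) : Prop :=
  (∀ y, ¬ H.Adj x y) ∨ (∃ b a, Leaf H b a ∧ (x = a ∨ x = b)) ∨ ∃ b c d e, Bas H x b c d e

lemma exists_maxIndep [Finite V] {S : Finset V} (hS : indepCpx H S) :
    ∃ M, S ⊆ M ∧ MaxIndep H M := by
  classical
  obtain ⟨M, hSM, hM⟩ := (Set.toFinite {T : Finset V | indepCpx H T}).exists_le_maximal hS
  refine ⟨M, hSM, hM.prop, fun v hv => ?_⟩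
  by_contra! hcon
  have := hM.le_of_ge (y := insert v M) (indepCpx.insert hM.prop hcon) (Finset.subset_insert _ _)
  exact hv (this (Finset.mem_insert_self _ _))

/-- The pendant edges exchange argument: no vertex of a maximal independent set has two
private neighbours. -/
lemma WellCovered.not_two_private [Finite V] (hW : WellCovered H) (hG : GirthFive H)
    {M : Finset V} (hM : MaxIndep H M) {a p q : V} (ha : a ∈ M) (hpq : p ≠ q)
    (hp : H.Adj a p) (hq : H.Adj a q) (hpM : ∀ y ∈ M, H.Adj p y → y = a)
    (hqM : ∀ y ∈ M, H.Adj q y → y = a) : False := by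
  classical
  obtain ⟨k, hk⟩ := hW
  have hnpq : ¬ H.Adj p q := fun h => hG.tri a p q hp h hq.symm
  have hpM' : p ∉ M := fun h => hM.1 a ha p h hp
  have hqM' : q ∉ M := fun h => hM.1 a ha q h hq
  have hind : indepCpx H (insert p (insert q (M.erase a))) := by
    refine indepCpx.insert (indepCpx.insert ?_ ?_) ?_
    · intro v hv w hw
      exact hM.1 v (Finset.mem_of_mem_erase hv) w (Finset.mem_of_mem_erase hw)
    · intro t ht h
      exact Finset.ne_of_mem_erase ht (hqM t (Finset.mem_of_mem_erase ht) h)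
    · intro t ht h
      rcases Finset.mem_insert.mp ht with rfl | ht
      · exact hnpq h
      · exact Finset.ne_of_mem_erase ht (hpM t (Finset.mem_of_mem_erase ht) h)
  obtain ⟨M', hsub, hM''⟩ := exists_maxIndep hind
  have h1 := Finset.card_le_card hsub
  rw [Finset.card_insert_of_notMem (by simp [hpq, hpM']),
    Finset.card_insert_of_notMem (by simp [hqM']), Finset.card_erase_of_mem ha, hk M hM,
    hk M' hM''] at h1
  have : 0 < M.card := Finset.card_pos.mpr ⟨a, ha⟩
  rw [hk M hM] at this
  omega

/-- The neighbour `p` of `a` is never private to `a`. -/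
def Abs (H : SimpleGraph V) (a p : V) : Prop :=
  ∀ M, MaxIndep H M → a ∈ M → ∃ y ∈ M, H.Adj p y ∧ y ≠ a

lemma Abs.exists_adj [Finite V] {a p : V} (h : Abs H a p) (s t : V) (hs : ¬ H.Adj a s)
    (ht : ¬ H.Adj a t) (hst : ¬ H.Adj s t) :
    ∃ y, H.Adj p y ∧ y ≠ a ∧ ¬ H.Adj y s ∧ ¬ H.Adj y t := by
  classical
  have hind : indepCpx H {a, s, t} := by
    refine indepCpx.insert (indepCpx.insert (T := {t}) ?_ ?_) ?_
    · simp [indepCpx]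
    · simpa using hst
    · simp [hs, ht]
  obtain ⟨M, hsub, hM⟩ := exists_maxIndep hind
  obtain ⟨y, hy, hpy, hya⟩ := h M hM (hsub (by simp))
  exact ⟨y, hpy, hya, fun h => hM.1 y hy s (hsub (by simp)) h,
    fun h => hM.1 y hy t (hsub (by simp)) h⟩

variable [Finite V]

lemma Leaf.abs (hW : WellCovered H) (hG : GirthFive H) {b a p : V} (hb : Leaf H b a)
    (hp : H.Adj a p) (hpb : p ≠ b) : Abs H a p := by
  intro M hM ha
  by_contra! hcon
  exact hW.not_two_private hG hM ha hpb hp hb.adj.symm hcon fun y _ h => hb.only y h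

lemma Leaf.unique (hW : WellCovered H) (hG : GirthFive H) {b b' a : V} (hb : Leaf H b a)
    (hb' : Leaf H b' a) : b' = b := by
  by_contra hne
  obtain ⟨y, hy, hya, -⟩ := (hb.abs hW hG hb'.adj.symm hne).exists_adj a a (by simp) (by simp)
    (by simp)
  exact hya (hb'.only y hy)

lemma Bas.abs (hW : WellCovered H) (hG : GirthFive H) {a p r s q x : V}
    (hB : Bas H a p r s q) (hx : H.Adj a x) (hxp : x ≠ p) (hxq : x ≠ q) : Abs H a x := by
  intro M hM ha
  by_contra! hcon
  have hsm : ¬ Sm H q a p := fun h => (h x hx).elim hxq hxp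
  have hp : Sm H a p r := hB.sab.resolve_left hsm
  have hq : Sm H s q a := hB.sea.resolve_right hsm
  have : r ∉ M ∨ s ∉ M := by
    by_contra! h
    exact hM.1 r h.1 s h.2 hB.cd
  rcases this with h | h
  · exact hW.not_two_private hG hM ha hxp hx hB.ab hcon fun y hy hpy =>
      (hp y hpy).resolve_right fun e => h (e ▸ hy)
  · exact hW.not_two_private hG hM ha hxq hx hB.ea.symm hcon fun y hy hpy =>
      (hq y hpy).resolve_left fun e => h (e ▸ hy)

lemma Bas.not_leaf (hW : WellCovered H) (hG : GirthFive H) {a p r s q b : V}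
    (hB : Bas H a p r s q) (hb : Leaf H b a) : False := by
  have hbp : b ≠ p := by
    rintro rfl
    have := hb.only r hB.bc
    subst this
    exact hG.tri r s q hB.cd hB.de hB.ea
  have hbq : b ≠ q := by
    rintro rfl
    have := hb.only s hB.de.symm
    subst this
    exact hG.tri s p r hB.ab hB.bc hB.cd
  obtain ⟨y, hy, hya, -⟩ := (hB.abs hW hG hb.adj.symm hbp hbq).exists_adj a a (by simp) (by simp)
    (by simp)
  exact hya (hb.only y hy)

lemma Bas.share (hW : WellCovered H) (hG : GirthFive H) {a p r s q p' r' s' q' : V}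
    (hB : Bas H a p r s q) (hB' : Bas H a p' r' s' q') : p' = p ∨ p' = q := by
  by_contra! hne
  have habs := hB.abs hW hG hB'.ab hne.1 hne.2
  obtain ⟨y, hy, hya, hys, -⟩ := habs.exists_adj s' s'
    (fun h => hG.tri a s' q' h hB'.de hB'.ea) (fun h => hG.tri a s' q' h hB'.de hB'.ea) (by simp)
  have hp' : Sm H a p' r' := by
    refine hB'.sab.resolve_left fun h => ?_
    have h1 := h p hB.ab
    have h2 := h q hB.ea.symm
    have hpq : p ≠ q := by
      rintro rfl
      exact hG.tri p r s hB.bc hB.cd hB.de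
    grind
  rcases hp' y hy with rfl | rfl
  · exact hya rfl
  · exact hys hB'.cd

end Structure

section Links
variable {V : Type} {H : SimpleGraph V}

/-- The link of `z`: delete all edges meeting the closed neighbourhood of `z`. -/
def del (H : SimpleGraph V) (z : V) : SimpleGraph V where
  Adj x y := H.Adj x y ∧ ¬ H.Adj z x ∧ ¬ H.Adj z y
  symm := ⟨fun _ _ h => ⟨h.1.symm, h.2.2, h.2.1⟩⟩
  loopless := ⟨fun _ h => H.irrefl h.1⟩

lemma del_adj {z x y : V} : (del H z).Adj x y ↔ H.Adj x y ∧ ¬ H.Adj z x ∧ ¬ H.Adj z y := Iff.rfl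

lemma del_lt {z y : V} (h : H.Adj z y) : del H z < H := by
  refine lt_of_le_of_ne (fun a b hab => hab.1) fun e => ?_
  have : (del H z).Adj z y := e.symm ▸ h
  exact this.2.2 h

lemma GirthFive.mono {H' : SimpleGraph V} (hG : GirthFive H) (h : H' ≤ H) : GirthFive H' :=
  ⟨fun a b c hab hbc hca => hG.tri a b c (h hab) (h hbc) (h hca),
    fun a b c d hab hbc hcd hda => hG.sq a b c d (h hab) (h hbc) (h hcd) (h hda)⟩

lemma WellCovered.del [Finite V] (hW : WellCovered H) (z : V) : WellCovered (del H z) := by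
  classical
  have := Fintype.ofFinite V
  obtain ⟨k, hk⟩ := hW
  refine ⟨k + (Finset.univ.filter fun y => H.Adj z y).card, fun S hS => ?_⟩
  set N := Finset.univ.filter fun y => H.Adj z y with hN
  have hmem : ∀ y, y ∈ N ↔ H.Adj z y := by simp [hN]
  have hiso : ∀ y, (y = z ∨ H.Adj z y) → y ∈ S := by
    intro y hy
    by_contra hyS
    obtain ⟨s, -, hs⟩ := hS.2 y hyS
    rcases hy with rfl | hy
    · exact hs.2.2 hs.1
    · exact hs.2.1 hy
  have hsub : N ⊆ S := fun y hy => hiso y (.inr ((hmem y).mp hy))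
  have hmax : MaxIndep H (S \ N) := by
    constructor
    · intro v hv w hw hvw
      rw [Finset.mem_sdiff, hmem] at hv hw
      exact hS.1 v hv.1 w hw.1 ⟨hvw, hv.2, hw.2⟩
    · intro v hv
      by_cases hvz : H.Adj z v
      · refine ⟨z, ?_, hvz.symm⟩
        rw [Finset.mem_sdiff, hmem]
        exact ⟨hiso z (.inl rfl), H.irrefl⟩
      · have hvS : v ∉ S := fun h => hv (by rw [Finset.mem_sdiff, hmem]; exact ⟨h, hvz⟩)
        obtain ⟨s, hs, hvs⟩ := hS.2 v hvS
        exact ⟨s, by rw [Finset.mem_sdiff, hmem]; exact ⟨hs, hvs.2.2⟩, hvs.1⟩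
  rw [← hk _ hmax, Finset.card_sdiff_add_card_eq_card hsub]

/-- There is no induced seven-cycle forming a connected component. -/
def NoHeptagon (H : SimpleGraph V) : Prop :=
  ∀ c₀ c₁ c₂ c₃ c₄ c₅ c₆ : V, [c₀, c₁, c₂, c₃, c₄, c₅, c₆].Nodup →
    DegTwo H c₀ c₆ c₁ → DegTwo H c₁ c₀ c₂ → DegTwo H c₂ c₁ c₃ → DegTwo H c₃ c₂ c₄ →
    DegTwo H c₄ c₃ c₅ → DegTwo H c₅ c₄ c₆ → DegTwo H c₆ c₅ c₀ → False

/-- `H` is obtained from `G` by deleting the closed neighbourhood of an independent set. -/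
def IsLink (G H : SimpleGraph V) : Prop :=
  ∃ F : Finset V, indepCpx G F ∧
    ∀ x y, H.Adj x y ↔ G.Adj x y ∧ ∀ f ∈ F, ¬ G.Adj f x ∧ ¬ G.Adj f y

lemma IsLink.refl (G : SimpleGraph V) : IsLink G G := ⟨∅, by simp [indepCpx], by simp⟩

lemma IsLink.le {G : SimpleGraph V} (h : IsLink G H) : H ≤ G := by
  obtain ⟨F, -, hF⟩ := h
  exact fun x y hxy => ((hF x y).mp hxy).1

lemma IsLink.del {G : SimpleGraph V} (h : IsLink G H) (z : V) : IsLink G (del H z) := by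
  classical
  obtain ⟨F, hF, hadj⟩ := h
  by_cases hz : ∃ f ∈ F, G.Adj f z
  · obtain ⟨f, hf, hfz⟩ := hz
    refine ⟨F, hF, fun x y => ?_⟩
    rw [del_adj, hadj, hadj, hadj]
    have h1 : ∀ x, ¬ (G.Adj z x ∧ ∀ f ∈ F, ¬ G.Adj f z ∧ ¬ G.Adj f x) :=
      fun x h => (h.2 f hf).1 hfz
    simp only [h1, not_false_eq_true, and_true]
  · push Not at hz
    refine ⟨insert z F, hF.insert fun t ht h => hz t ht h.symm, fun x y => ?_⟩
    rw [del_adj, hadj, hadj, hadj]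
    simp only [Finset.mem_insert, forall_eq_or_imp]
    constructor
    · rintro ⟨⟨h1, h2⟩, h3, h4⟩
      exact ⟨h1, ⟨fun h => h3 ⟨h, fun f hf => ⟨hz f hf, (h2 f hf).1⟩⟩,
        fun h => h4 ⟨h, fun f hf => ⟨hz f hf, (h2 f hf).2⟩⟩⟩, h2⟩
    · rintro ⟨h1, ⟨h3, h4⟩, h2⟩
      exact ⟨⟨h1, h2⟩, fun h => h3 h.1, fun h => h4 h.1⟩

lemma KoszulCM.noHeptagon_of_isLink {K : Type} [Field K] [Fintype V] {G : SimpleGraph V} {d : ℕ}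
    (hCM : KoszulCM K G d) (h : IsLink G H) : NoHeptagon H := by
  classical
  obtain ⟨F, hF, hadj⟩ := h
  intro c₀ c₁ c₂ c₃ c₄ c₅ c₆ hnd d0 d1 d2 d3 d4 d5 d6
  set C := [c₀, c₁, c₂, c₃, c₄, c₅, c₆] with hC
  have hex : ∀ c ∈ C, ∃ y ∈ C, H.Adj c y := by
    simp only [hC, List.mem_cons, List.not_mem_nil, or_false, forall_eq_or_imp, forall_eq]
    exact ⟨⟨c₁, by simp, d0.right⟩, ⟨c₂, by simp, d1.right⟩, ⟨c₃, by simp, d2.right⟩,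
      ⟨c₄, by simp, d3.right⟩, ⟨c₅, by simp, d4.right⟩, ⟨c₆, by simp, d5.right⟩,
      ⟨c₀, by simp, d6.right⟩⟩
  have hclosed : ∀ c ∈ C, ∀ y, H.Adj c y → y ∈ C := by
    simp only [hC, List.mem_cons, List.not_mem_nil, or_false, forall_eq_or_imp, forall_eq]
    refine ⟨fun y hy => ?_, fun y hy => ?_, fun y hy => ?_, fun y hy => ?_, fun y hy => ?_,
      fun y hy => ?_, fun y hy => ?_⟩
    · rcases d0.sm y hy with h | h <;> simp [h]
    · rcases d1.sm y hy with h | h <;> simp [h]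
    · rcases d2.sm y hy with h | h <;> simp [h]
    · rcases d3.sm y hy with h | h <;> simp [h]
    · rcases d4.sm y hy with h | h <;> simp [h]
    · rcases d5.sm y hy with h | h <;> simp [h]
    · rcases d6.sm y hy with h | h <;> simp [h]
  have hFc : ∀ c ∈ C, ∀ f ∈ F, ¬ G.Adj f c := by
    intro c hc f hf
    obtain ⟨y, -, hy⟩ := hex c hc
    exact (((hadj _ _).mp hy).2 f hf).1
  have hHG : ∀ c ∈ C, ∀ c' ∈ C, G.Adj c c' → H.Adj c c' := fun c hc c' hc' h =>
    (hadj _ _).mpr ⟨h, fun f hf => ⟨hFc c hc f hf, hFc c' hc' f hf⟩⟩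
  obtain ⟨T, hFT, hT⟩ := (Set.toFinite {T : Finset V | indepCpx G T ∧
    ∀ c ∈ C, c ∉ T ∧ ∀ t ∈ T, ¬ G.Adj c t}).exists_le_maximal (a := F) ⟨hF, fun c hc =>
      ⟨fun hcF => by
        obtain ⟨y, hyC, hy⟩ := hex c hc
        exact hFc y hyC c hcF ((hadj _ _).mp hy).1, fun t ht h => hFc c hc t ht h.symm⟩⟩
  have non : ∀ c ∈ C, ∀ c' ∈ C, ∀ a b, Sm H a c b → c' ≠ a → c' ≠ b → ¬ G.Adj c c' :=
    fun c hc c' hc' a b hs h1 h2 h => (hs c' (hHG c hc c' hc' h)).elim h1 h2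
  have hn := hnd
  simp only [hC, List.nodup_cons, List.mem_cons, not_or, List.not_mem_nil, not_false_eq_true,
    and_true] at hn
  obtain ⟨⟨h0_1, h0_2, h0_3, h0_4, h0_5, h0_6⟩, ⟨h1_2, h1_3, h1_4, h1_5, h1_6⟩,
    ⟨h2_3, h2_4, h2_5, h2_6⟩, ⟨h3_4, h3_5, h3_6⟩, ⟨h4_5, h4_6⟩, h5_6, -⟩ := hn
  have toG : ∀ {x y}, H.Adj x y → G.Adj x y := fun h => ((hadj _ _).mp h).1
  refine hCM.no_heptagon hT.prop.1 hnd (toG d0.right) (toG d1.right) (toG d2.right)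
    (toG d3.right) (toG d4.right) (toG d5.right) (toG d6.right)
    (non c₁ (by simp [hC]) c₆ (by simp [hC]) _ _ d1.sm (Ne.symm h0_6) (Ne.symm h2_6))
    (non c₁ (by simp [hC]) c₅ (by simp [hC]) _ _ d1.sm (Ne.symm h0_5) (Ne.symm h2_5))
    (non c₂ (by simp [hC]) c₆ (by simp [hC]) _ _ d2.sm (Ne.symm h1_6) (Ne.symm h3_6))
    (non c₂ (by simp [hC]) c₅ (by simp [hC]) _ _ d2.sm (Ne.symm h1_5) (Ne.symm h3_5))
    (non c₀ (by simp [hC]) c₂ (by simp [hC]) _ _ d0.sm h2_6 (Ne.symm h1_2))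
    (non c₀ (by simp [hC]) c₄ (by simp [hC]) _ _ d0.sm h4_6 (Ne.symm h1_4))
    (non c₂ (by simp [hC]) c₄ (by simp [hC]) _ _ d2.sm (Ne.symm h1_4) (Ne.symm h3_4))
    hT.prop.2 fun u huT huC => ?_
  by_contra! hcon
  have huc : ∀ c ∈ C, ¬ G.Adj c u := by
    intro c hc hcu
    refine huC (hclosed c hc u ((hadj _ _).mpr ⟨hcu, fun f hf => ⟨hFc c hc f hf, fun h => ?_⟩⟩))
    exact hcon f (hFT hf) h.symm
  have := hT.le_of_ge (y := insert u T) ⟨hT.prop.1.insert hcon, fun c hc => ⟨?_, ?_⟩⟩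
    (Finset.subset_insert _ _)
  · exact huT (this (Finset.mem_insert_self _ _))
  · rw [Finset.mem_insert, not_or]
    exact ⟨fun h => huC (h ▸ hc), (hT.prop.2 c hc).1⟩
  · intro t ht
    rcases Finset.mem_insert.mp ht with rfl | ht
    · exact huc c hc
    · exact (hT.prop.2 c hc).2 t ht

end Links

section Glue
variable {V : Type} {H H' : SimpleGraph V}

lemma Bas.ne (hG : GirthFive H) {a b c d e : V} (h : Bas H a b c d e) : a ≠ c := by
  rintro rfl
  exact hG.tri a d e h.cd h.de h.ea

lemma Bas.good {a b c d e x : V} (h : Bas H a b c d e)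
    (hx : x = a ∨ x = b ∨ x = c ∨ x = d ∨ x = e) : Good H x := by
  refine .inr (.inr ?_)
  rcases hx with rfl | rfl | rfl | rfl | rfl
  exacts [⟨_, _, _, _, h⟩, ⟨_, _, _, _, h.rot⟩, ⟨_, _, _, _, h.rot.rot⟩,
    ⟨_, _, _, _, h.rot.rot.rot⟩, ⟨_, _, _, _, h.rot.rot.rot.rot⟩]

lemma Leaf.good {a b x : V} (h : Leaf H b a) (hx : x = a ∨ x = b) : Good H x :=
  .inr (.inl ⟨b, a, h, hx⟩)

/-- `H'` is obtained from `H` by deleting the vertices of `Q`, and the neighbours of `Q`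
outside `Q` are never private to vertices of `Q`. -/
structure Glue (H H' : SimpleGraph V) (Q : Set V) : Prop where
  adj : ∀ x y, H'.Adj x y ↔ H.Adj x y ∧ x ∉ Q ∧ y ∉ Q
  abs : ∀ a ∈ Q, ∀ p ∉ Q, H.Adj a p → Abs H a p
  one : ∀ p ∉ Q, ∀ a ∈ Q, ∀ a' ∈ Q, H.Adj a p → H.Adj a' p → a = a'

variable [Finite V] {Q : Set V}

lemma Glue.bas_aux (hG : GirthFive H) (g : Glue H H' Q) {c₁ c₂ c₃ c₄ c₅ : V}
    (h : Bas H' c₁ c₂ c₃ c₄ c₅) (hs : Sm H' c₁ c₂ c₃) : Sm H c₁ c₂ c₃ ∨ Sm H c₂ c₃ c₄ := by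
  obtain ⟨h12, q1, q2⟩ := (g.adj _ _).mp h.ab
  obtain ⟨h23, -, q3⟩ := (g.adj _ _).mp h.bc
  obtain ⟨h34, -, q4⟩ := (g.adj _ _).mp h.cd
  obtain ⟨h45, -, q5⟩ := (g.adj _ _).mp h.de
  obtain ⟨h51, -, -⟩ := (g.adj _ _).mp h.ea
  have hG' : GirthFive H' := hG.mono fun x y hxy => ((g.adj _ _).mp hxy).1
  have n52 : c₅ ≠ c₂ := h.rot.rot.rot.rot.ne hG'
  by_cases hit : ∃ a ∈ Q, H.Adj a c₂
  · obtain ⟨a, ha, hac⟩ := hit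
    right
    intro z hz
    by_contra! hne
    obtain ⟨y, hy, hya, hyz, hyc⟩ := (g.abs a ha c₂ q2 hac).exists_adj z c₅
      (fun h => (hG.sq a c₂ c₃ z hac h23 hz h.symm).elim (fun e => q3 (e ▸ ha))
        (fun e => hne.1 e.symm))
      (fun h => (hG.sq a c₂ c₁ c₅ hac h12.symm h51.symm h.symm).elim (fun e => q1 (e ▸ ha))
        (fun e => n52 e.symm))
      (fun h => (hG.sq z c₅ c₄ c₃ h h45.symm h34.symm hz).elim hne.2
        (fun e => hG.tri c₁ c₂ c₃ h12 h23 (e ▸ h51)))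
    by_cases hyQ : y ∈ Q
    · exact hya (g.one c₂ q2 y hyQ a ha hy.symm hac)
    · rcases hs y ((g.adj _ _).mpr ⟨hy, q2, hyQ⟩) with rfl | rfl
      · exact hyc h51.symm
      · exact hyz hz
  · left
    intro y hy
    exact hs y ((g.adj _ _).mpr ⟨hy, q2, fun h => hit ⟨y, h, hy.symm⟩⟩)

lemma Glue.bas_clause (hG : GirthFive H) (g : Glue H H' Q) {c₁ c₂ c₃ c₄ c₅ : V}
    (h : Bas H' c₁ c₂ c₃ c₄ c₅) : Sm H c₁ c₂ c₃ ∨ Sm H c₂ c₃ c₄ := by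
  rcases h.sbc with hs | hs
  · exact g.bas_aux hG h hs
  · have := g.bas_aux hG h.refl.rot.rot hs.symm
    exact this.symm.imp Sm.symm Sm.symm

lemma Glue.bas (hG : GirthFive H) (g : Glue H H' Q) {c₁ c₂ c₃ c₄ c₅ : V}
    (h : Bas H' c₁ c₂ c₃ c₄ c₅) : Bas H c₁ c₂ c₃ c₄ c₅ :=
  ⟨((g.adj _ _).mp h.ab).1, ((g.adj _ _).mp h.bc).1, ((g.adj _ _).mp h.cd).1,
    ((g.adj _ _).mp h.de).1, ((g.adj _ _).mp h.ea).1, g.bas_clause hG h.rot.rot.rot.rot,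
    g.bas_clause hG h, g.bas_clause hG h.rot, g.bas_clause hG h.rot.rot,
    g.bas_clause hG h.rot.rot.rot⟩

lemma Glue.good (hG : GirthFive H) (g : Glue H H' Q) {x : V} (hx : x ∉ Q) (h : Good H' x) :
    Good H x := by
  rcases h with h | ⟨l, s, h, hxl⟩ | ⟨b, c, d, e, h⟩
  · have hQ : ∀ y, H.Adj x y → y ∈ Q := fun y hy => by
      by_contra hyQ
      exact h y ((g.adj _ _).mpr ⟨hy, hx, hyQ⟩)
    by_cases hiso : ∃ y, H.Adj x y
    · obtain ⟨y, hy⟩ := hiso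
      exact Leaf.good ⟨hy, fun y' hy' => g.one x hx y' (hQ y' hy') y (hQ y hy) hy'.symm hy.symm⟩
        (.inr rfl)
    · push Not at hiso
      exact .inl hiso
  · obtain ⟨hls, ql, qs⟩ := (g.adj _ _).mp h.adj
    by_cases hit : ∃ a ∈ Q, H.Adj a l
    · obtain ⟨a, ha, hal⟩ := hit
      refine Leaf.good (a := l) (b := s) ⟨hls.symm, fun t ht => ?_⟩ hxl.symm
      by_contra htl
      have hat : ¬ H.Adj a t := fun h =>
        (hG.sq a l s t hal hls ht h.symm).elim (fun e => qs (e ▸ ha)) (fun e => htl e.symm)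
      obtain ⟨y, hy, hya, hyt, -⟩ := (g.abs a ha l ql hal).exists_adj t t hat hat (by simp)
      by_cases hyQ : y ∈ Q
      · exact hya (g.one l ql y hyQ a ha hy.symm hal)
      · obtain rfl := h.only y ((g.adj _ _).mpr ⟨hy, ql, hyQ⟩)
        exact hyt ht
    · exact Leaf.good ⟨hls, fun y hy => h.only y ((g.adj _ _).mpr
        ⟨hy, ql, fun hyQ => hit ⟨y, hyQ, hy.symm⟩⟩)⟩ hxl
  · exact (g.bas hG h).good (.inl rfl)

lemma Leaf.glue (hW : WellCovered H) (hG : GirthFive H) {a b : V} (hb : Leaf H b a) :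
    Glue H (del H b) {a, b} := by
  refine ⟨fun x y => ?_, ?_, ?_⟩
  · have h1 : ∀ x, H.Adj b x ↔ x = a := fun x => ⟨hb.only x, fun h => h ▸ hb.adj⟩
    simp only [del_adj, h1, Set.mem_insert_iff, Set.mem_singleton_iff, not_or]
    constructor
    · rintro ⟨h, hx, hy⟩
      exact ⟨h, ⟨hx, fun e => hy (hb.only y (e ▸ h))⟩, hy, fun e => hx (hb.only x (e ▸ h.symm))⟩
    · rintro ⟨h, hx, hy⟩
      exact ⟨h, hx.1, hy.1⟩
  · simp only [Set.mem_insert_iff, Set.mem_singleton_iff, not_or]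
    rintro _ (rfl | rfl) p hp hadj
    · exact hb.abs hW hG hadj hp.2
    · exact absurd (hb.only p hadj) hp.1
  · simp only [Set.mem_insert_iff, Set.mem_singleton_iff, not_or]
    rintro p hp x (rfl | rfl) y (rfl | rfl) h h'
    · rfl
    · exact absurd (hb.only p h') hp.1
    · exact absurd (hb.only p h) hp.1
    · rfl

lemma Bas.glue (hW : WellCovered H) (hG : GirthFive H) {a b c d e : V} (h : Bas H a b c d e)
    (hb : Sm H a b c) (hd : Sm H c d e) (he : Sm H d e a) :
    Glue H (del (del H b) d) {a, b, c, d, e} := by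
  have hadj : ∀ x y, (Stmt.del (Stmt.del H b) d).Adj x y ↔
      H.Adj x y ∧ x ∉ ({a, b, c, d, e} : Set V) ∧ y ∉ ({a, b, c, d, e} : Set V) := by
    have n1 := h.ne hG
    have n2 := h.rot.ne hG
    have n3 := h.rot.rot.ne hG
    have n4 := h.rot.rot.rot.ne hG
    have n5 := h.rot.rot.rot.rot.ne hG
    have h1 : ∀ x, H.Adj b x ↔ x = a ∨ x = c := fun x =>
      ⟨hb x, by rintro (rfl | rfl); exacts [h.ab.symm, h.bc]⟩
    have h2 : ∀ x, H.Adj d x ↔ x = c ∨ x = e := fun x =>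
      ⟨hd x, by rintro (rfl | rfl); exacts [h.cd.symm, h.de]⟩
    intro x y
    simp only [del_adj, h1, h2, Set.mem_insert_iff, Set.mem_singleton_iff, not_or]
    have h3 : ∀ x, H.Adj x b → x = a ∨ x = c := fun x hx => (h1 x).mp hx.symm
    have h4 : ∀ x, H.Adj x d → x = c ∨ x = e := fun x hx => (h2 x).mp hx.symm
    have n6 := h.cd.ne
    grind [SimpleGraph.irrefl]
  refine ⟨hadj, ?_, ?_⟩
  · simp only [Set.mem_insert_iff, Set.mem_singleton_iff, not_or]
    rintro _ (rfl | rfl | rfl | rfl | rfl) p ⟨p1, p2, p3, p4, p5⟩ hp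
    · exact h.abs hW hG hp p2 p5
    · exact h.rot.abs hW hG hp p3 p1
    · exact h.rot.rot.abs hW hG hp p4 p2
    · exact h.rot.rot.rot.abs hW hG hp p5 p3
    · exact h.rot.rot.rot.rot.abs hW hG hp p1 p4
  · simp only [Set.mem_insert_iff, Set.mem_singleton_iff, not_or]
    rintro p ⟨p1, p2, p3, p4, p5⟩ x hx y hy hxp hyp
    have hxac : x = a ∨ x = c := by
      rcases hx with rfl | rfl | rfl | rfl | rfl
      · exact .inl rfl
      · exact ((hb p hxp).elim p1 p3).elim
      · exact .inr rfl
      · exact ((hd p hxp).elim p3 p5).elim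
      · exact ((he p hxp).elim p4 p1).elim
    have hyac : y = a ∨ y = c := by
      rcases hy with rfl | rfl | rfl | rfl | rfl
      · exact .inl rfl
      · exact ((hb p hyp).elim p1 p3).elim
      · exact .inr rfl
      · exact ((hd p hyp).elim p3 p5).elim
      · exact ((he p hyp).elim p4 p1).elim
    have key : ∀ p, H.Adj a p → H.Adj c p → p = b := fun p h1 h2 =>
      (hG.sq a p c b h1 h2.symm h.bc.symm h.ab.symm).resolve_left (h.ne hG)
    rcases hxac with rfl | rfl <;> rcases hyac with rfl | rfl
    · rfl
    · exact absurd (key p hxp hyp) p2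
    · exact absurd (key p hyp hxp) p2
    · rfl

omit [Finite V] in
/-- Some rotation of a basic five-cycle has its second, fourth and fifth vertices small. -/
lemma Bas.exists_rot {a b c d e : V} (h : Bas H a b c d e) :
    ∃ a' b' c' d' e', Bas H a' b' c' d' e' ∧ Sm H a' b' c' ∧ Sm H c' d' e' ∧ Sm H d' e' a' ∧
      ∀ x, (x = a' ∨ x = b' ∨ x = c' ∨ x = d' ∨ x = e') ↔
        (x = a ∨ x = b ∨ x = c ∨ x = d ∨ x = e) := by
  have : (Sm H a b c ∧ Sm H c d e ∧ Sm H d e a) ∨ (Sm H b c d ∧ Sm H d e a ∧ Sm H e a b) ∨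
      (Sm H c d e ∧ Sm H e a b ∧ Sm H a b c) ∨ (Sm H d e a ∧ Sm H a b c ∧ Sm H b c d) ∨
      (Sm H e a b ∧ Sm H b c d ∧ Sm H c d e) := by
    have := h.sab; have := h.sbc; have := h.scd; have := h.sde; have := h.sea
    tauto
  rcases this with h' | h' | h' | h' | h'
  · exact ⟨_, _, _, _, _, h, h'.1, h'.2.1, h'.2.2, fun x => by tauto⟩
  · exact ⟨_, _, _, _, _, h.rot, h'.1, h'.2.1, h'.2.2, fun x => by tauto⟩
  · exact ⟨_, _, _, _, _, h.rot.rot, h'.1, h'.2.1, h'.2.2, fun x => by tauto⟩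
  · exact ⟨_, _, _, _, _, h.rot.rot.rot, h'.1, h'.2.1, h'.2.2, fun x => by tauto⟩
  · exact ⟨_, _, _, _, _, h.rot.rot.rot.rot, h'.1, h'.2.1, h'.2.2, fun x => by tauto⟩

lemma Leaf.good_all (hW : WellCovered H) (hG : GirthFive H) {a b : V} (hb : Leaf H b a)
    (IH : ∀ x, Good (del H b) x) (x : V) : Good H x := by
  by_cases hx : x ∈ ({a, b} : Set V)
  · exact hb.good (by simpa using hx)
  · exact (hb.glue hW hG).good hG hx (IH x)

lemma Bas.good_all (hW : WellCovered H) (hG : GirthFive H) {a b c d e : V} (h : Bas H a b c d e)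
    (IH : ∀ u v y, H.Adj u y → ∀ x, Good (del (del H u) v) x) (x : V) : Good H x := by
  obtain ⟨a, b, c, d, e, h, hb, hd, he, -⟩ := h.exists_rot
  by_cases hx : x ∈ ({a, b, c, d, e} : Set V)
  · exact h.good (by simpa using hx)
  · exact (h.glue hW hG hb hd he).good hG hx (IH _ _ _ h.bc x)

end Glue

section Critical
variable {V : Type} [Finite V] {H : SimpleGraph V}

omit [Finite V] in
/-- A good vertex of degree two, none of whose neighbours is a leaf, lies on a basic
five-cycle. -/
lemma Good.bas (hG : GirthFive H) {x y y' z z' : V} (h : Good H x) (hy : H.Adj x y)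
    (hy' : H.Adj x y') (hne : y ≠ y') (hs : Sm H y x y') (hz : H.Adj y z) (hzx : z ≠ x)
    (hz' : H.Adj y' z') (hzx' : z' ≠ x) : ∃ p q, Bas H x y p q y' := by
  rcases h with h | ⟨b, a, h, rfl | rfl⟩ | ⟨b, c, d, e, h⟩
  · exact absurd hy (h y)
  · rcases hs b h.adj.symm with rfl | rfl
    · exact absurd (h.only z hz) hzx
    · exact absurd (h.only z' hz') hzx'
  · exact absurd ((h.only y hy).trans (h.only y' hy').symm) hne
  · have hne' := h.rot.rot.rot.rot.ne hG
    rcases hs b h.ab with rfl | rfl <;> rcases hs e h.ea.symm with rfl | rfl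
    · exact absurd rfl hne'
    · exact ⟨_, _, h⟩
    · exact ⟨_, _, h.refl⟩
    · exact absurd rfl hne'

/-- A hypothetical minimal counterexample to every vertex being good. -/
structure Crit (H : SimpleGraph V) : Prop where
  wc : WellCovered H
  girth : GirthFive H
  hept : NoHeptagon H
  good : ∀ z y, H.Adj z y → ∀ x, Good (del H z) x
  noleaf : ∀ x y, H.Adj x y → ∃ z, z ≠ y ∧ H.Adj x z
  nobas : ∀ a b c d e, ¬ Bas H a b c d e

omit [Finite V] in
lemma Crit.delGirth (_ : Crit H) (hG : GirthFive H) (z : V) : GirthFive (del H z) :=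
  hG.mono fun _ _ h => h.1

omit [Finite V] in
lemma degTwo_bas {u v w w' s : V} (hv : DegTwo H v w w') (hu : DegTwo H u w s)
    (h : H.Adj s w') (hs : Sm H u s w' ∨ Sm H s w' v) : Bas H v w u s w' :=
  ⟨hv.left, hu.left.symm, hu.right, h, hv.right.symm, .inl hv.sm.symm, .inr hu.sm, .inl hu.sm, hs,
    .inr hv.sm.symm⟩

variable (hC : Crit H)
include hC

lemma Crit.degTwo_of_adj {u v w w' s t : V} (hv : DegTwo H v w w') (hu : DegTwo H u w s)
    (hvu : v ≠ u) (hts : H.Adj t s) (htu : t ≠ u) (htw : t ≠ w') :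
    ∃ r, DegTwo H w' v r ∧ H.Adj r t := by
  have tri := hC.girth.tri
  have sq := hC.girth.sq
  have g' := hC.delGirth hC.girth t
  have hwt : w ≠ t := by
    rintro rfl
    exact tri w s u hts hu.right.symm hu.left
  have hut : ¬ H.Adj t u := fun h => (hu.sm t h.symm).elim (fun e => hwt e.symm)
    (fun e => H.irrefl (e ▸ hts))
  have hwt' : ¬ H.Adj t w := fun h =>
    (sq t w u s h hu.left.symm hu.right hts.symm).elim htu (fun e => hu.ne e)
  have hvt : ¬ H.Adj t v := fun h => (hv.sm t h.symm).elim (fun e => hwt e.symm) htw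
  have hleaf : Leaf (del H t) u w := ⟨⟨hu.left, hut, hwt'⟩, fun y hy =>
    (hu.sm y hy.1).resolve_right fun e => hy.2.2 (e ▸ hts)⟩
  have hwt2 : ¬ H.Adj t w' := fun h => hvu (hleaf.unique (hC.wc.del t) g'
    (b' := v) ⟨⟨hv.left, hvt, hwt'⟩, fun y hy =>
      (hv.sm y hy.1).resolve_right fun e => hy.2.2 (e ▸ h)⟩)
  have hall : ∀ r, H.Adj w' r → r ≠ v → H.Adj r t := by
    intro r hr hrv
    by_contra hrt
    obtain ⟨p, q, hB⟩ := (hC.good t s hts v).bas g' ⟨hv.left, hvt, hwt'⟩ ⟨hv.right, hvt, hwt2⟩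
      hv.ne (fun y hy => hv.sm y hy.1) (z := u) ⟨hu.left.symm, hwt', hut⟩ hvu.symm (z' := r)
      ⟨hr, hwt2, fun h => hrt h.symm⟩ hrv
    exact hB.rot.not_leaf (hC.wc.del t) g' hleaf
  obtain ⟨r, hrv, hr⟩ := hC.noleaf w' v hv.right.symm
  refine ⟨r, ⟨hrv.symm, hv.right.symm, hr, fun y hy => ?_⟩, hall r hr hrv⟩
  by_contra! hne
  exact (sq w' r t y hr (hall r hr hrv) (hall y hy hne.1).symm hy.symm).elim htw.symm hne.2.symm

lemma Crit.path_of_degTwo {u v w w' s : V} (hv : DegTwo H v w w') (hu : DegTwo H u w s)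
    (hvu : v ≠ u) : ∃ r t, DegTwo H w' v r ∧ DegTwo H s u t ∧ H.Adj r t ∧ r ≠ s ∧ t ≠ w' := by
  obtain ⟨t, hts, htu, htw⟩ : ∃ t, H.Adj t s ∧ t ≠ u ∧ t ≠ w' := by
    by_contra! hcon
    obtain ⟨z, hzu, hz⟩ := hC.noleaf s u hu.right.symm
    obtain rfl := hcon z hz.symm hzu
    refine hC.nobas _ _ _ _ _ (degTwo_bas hv hu hz (.inl fun y hy => ?_))
    by_contra! hne
    exact hne.2 (hcon y hy.symm hne.1)
  obtain ⟨r, hr, hrt⟩ := hC.degTwo_of_adj hv hu hvu hts htu htw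
  have hrs : r ≠ s := by
    rintro rfl
    exact hC.nobas _ _ _ _ _ (degTwo_bas hv hu hr.right.symm (.inr hr.sm.symm))
  obtain ⟨t', ht', htr⟩ := hC.degTwo_of_adj hu hv hvu.symm hr.right.symm hr.ne.symm hrs
  obtain rfl : t = t' := (ht'.sm t hts.symm).resolve_left htu
  exact ⟨r, t, hr, ht', hrt, hrs, htw⟩

omit [Finite V] in
lemma Crit.sm_of_heptagon {u v w w' s r t : V} (hv : DegTwo H v w w') (hu : DegTwo H u w s)
    (hvu : v ≠ u) (hr : DegTwo H w' v r) (ht : DegTwo H s u t) (hrt : H.Adj r t) (hrs : r ≠ s)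
    (htw : t ≠ w') (hw : Sm H v w u) : Sm H w' r t := by
  have tri := hC.girth.tri
  have sq := hC.girth.sq
  intro ρ hρ
  by_contra! hne
  have g' := hC.delGirth hC.girth ρ
  have hww : ¬ H.Adj w w' := fun h => tri v w w' hv.left h hv.right.symm
  have hwr : ¬ H.Adj r w := fun h =>
    (sq v w r w' hv.left h.symm hr.right.symm hv.right.symm).elim hr.ne hv.ne
  have hus : ¬ H.Adj r s := fun h => tri r t s hrt ht.right.symm h.symm
  have h1 : ¬ H.Adj ρ w' := fun h => tri ρ w' r h hr.right hρ
  have h2 : ¬ H.Adj ρ v := fun h => (hv.sm ρ h.symm).elim (fun e => hwr (e ▸ hρ)) hne.1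
  have h3 : ¬ H.Adj ρ u := fun h => (hu.sm ρ h.symm).elim (fun e => hwr (e ▸ hρ))
    (fun e => hus (e ▸ hρ))
  have h4 : ¬ H.Adj ρ w := fun h => (hw ρ h.symm).elim
    (fun e => (hv.sm r (e ▸ hρ.symm)).elim (fun e => hww (e ▸ hr.right.symm))
      (fun e => H.irrefl (e ▸ hr.right)))
    (fun e => (hu.sm r (e ▸ hρ.symm)).elim (fun e => hww (e ▸ hr.right.symm)) hrs)
  have h5 : ¬ H.Adj ρ s := fun h => (ht.sm ρ h.symm).elim
    (fun e => (hu.sm r (e ▸ hρ.symm)).elim (fun e => hww (e ▸ hr.right.symm)) hrs) hne.2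
  have hleaf : Leaf (del H ρ) w' v := ⟨⟨hv.right.symm, h1, h2⟩, fun y hy =>
    (hr.sm y hy.1).resolve_right fun e => hy.2.2 (e ▸ hρ.symm)⟩
  obtain ⟨p, q, hB⟩ := (hC.good ρ r hρ.symm w).bas g' (y := v) (y' := u) ⟨hv.left.symm, h4, h2⟩
    ⟨hu.left.symm, h4, h3⟩ hvu (fun y hy => hw y hy.1) (z := w') ⟨hv.right, h2, h1⟩ hv.ne.symm
    (z' := s) ⟨hu.right, h3, h5⟩ hu.ne.symm
  obtain rfl : p = w' := (hv.sm p hB.bc.1).resolve_left (hB.ne g').symm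
  exact hB.rot.ne g' (hleaf.only q hB.cd).symm

lemma Crit.degTwo_unique {u v w w' s : V} (hv : DegTwo H v w w') (hu : DegTwo H u w s) :
    u = v := by
  have tri := hC.girth.tri
  have sq := hC.girth.sq
  by_contra huv
  have hvu : v ≠ u := fun h => huv h.symm
  obtain ⟨r, t, hr, ht, hrt, hrs, htw⟩ := hC.path_of_degTwo hv hu hvu
  have hww : ¬ H.Adj w w' := fun h => tri v w w' hv.left h hv.right.symm
  have hws : ¬ H.Adj w s := fun h => tri u w s hu.left h hu.right.symm
  have hvs : ¬ H.Adj v s := fun h => (hv.sm s h).elim (fun e => hu.ne e.symm) (fun e => by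
    subst e; exact (sq v w u s hv.left hu.left.symm hu.right h.symm).elim hvu hv.ne)
  have hus' : ¬ H.Adj u w' := fun h => (hu.sm w' h).elim (fun e => hv.ne e.symm) (fun e => by
    subst e; exact (sq v w u w' hv.left hu.left.symm hu.right hv.right.symm).elim hvu hv.ne)
  have hsw : ¬ H.Adj s w' := fun h => (ht.sm w' h).elim
    (fun e => hww (e ▸ hu.left.symm)) (fun e => htw e.symm)
  have hvu' : ¬ H.Adj v u := fun h => tri v u w h hu.left hv.left.symm
  by_cases hw : Sm H v w u
  · have hr' := hC.sm_of_heptagon hv hu hvu hr ht hrt hrs htw hw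
    have ht' := hC.sm_of_heptagon hu hv hvu.symm ht hr hrt.symm htw hrs hw.symm
    refine hC.hept w v w' r t s u ?_ ⟨hvu.symm, hu.left.symm, hv.left.symm, hw.symm⟩ hv hr
      ⟨htw.symm, hr.right.symm, hrt, hr'⟩ ⟨hrs, hrt.symm, ht.right.symm, ht'.symm⟩ ht.symm hu.symm
    have n1 : w ≠ r := fun e => hww (e ▸ hr.right.symm)
    have n2 : w ≠ t := fun e => hws (e ▸ ht.right.symm)
    have n3 : v ≠ t := fun e => hvs (e ▸ ht.right.symm)
    have n4 : v ≠ s := fun e => hvu' (e ▸ hu.right.symm)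
    have n5 : w' ≠ s := fun e => hus' (e ▸ hu.right)
    have n6 : w' ≠ u := fun e => hvu' (e ▸ hv.right)
    have n7 : r ≠ u := fun e => hus' (e ▸ hr.right.symm)
    simp [hv.left.ne.symm, hv.ne, n1, n2, hu.ne, hu.left.ne.symm, hv.right.ne, hr.ne, n3, n4, hvu,
      hr.right.ne, htw.symm, n5, n6, hrt.ne, hrs, n7, ht.right.ne.symm, ht.ne.symm, hu.right.ne.symm]
  · have hx : ∃ x, H.Adj w x ∧ x ≠ v ∧ x ≠ u := by
      by_contra! hcon
      exact hw fun y hy => or_iff_not_imp_left.mpr (hcon y hy)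
    obtain ⟨x, hwx, hxv, hxu⟩ := hx
    have hxw : ¬ H.Adj x w' := fun h =>
      (sq x w v w' hwx.symm hv.left.symm hv.right h.symm).elim hxv hv.ne
    have hxs : ¬ H.Adj x s := fun h =>
      (sq x w u s hwx.symm hu.left.symm hu.right h.symm).elim hxu hu.ne
    have htw' : ¬ H.Adj t w' := fun h => tri t w' r h hr.right hrt
    have hrs' : ¬ H.Adj r s := fun h => tri r s t h ht.right hrt.symm
    have hvw : ¬ H.Adj w' w := fun h => hww h.symm
    have hB1 : ∃ m, Bas (del H w') u w m t s := by
      obtain ⟨m, q, hB⟩ := (hC.good w' v hv.right.symm u).bas (hC.delGirth hC.girth w')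
        (y := w) (y' := s) (z := x) (z' := t)
        ⟨hu.left, fun h => hus' h.symm, hvw⟩ ⟨hu.right, fun h => hus' h.symm, fun h => hsw h.symm⟩
        hu.ne (fun y hy => hu.sm y hy.1) ⟨hwx, hvw, fun h => hxw h.symm⟩ hxu
        ⟨ht.right, fun h => hsw h.symm, fun h => htw' h.symm⟩ ht.ne.symm
      obtain rfl : q = t := (ht.sm q hB.de.symm.1).resolve_left
        (hB.rot.rot.rot.ne (hC.delGirth hC.girth w'))
      exact ⟨m, hB⟩
    have hB2 : ∃ m, Bas (del H s) v w m r w' := by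
      obtain ⟨m, q, hB⟩ := (hC.good s u hu.right.symm v).bas (hC.delGirth hC.girth s)
        (y := w) (y' := w') (z := x) (z' := r)
        ⟨hv.left, fun h => hvs h.symm, fun h => hws h.symm⟩ ⟨hv.right, fun h => hvs h.symm, hsw⟩
        hv.ne (fun y hy => hv.sm y hy.1) ⟨hwx, fun h => hws h.symm, fun h => hxs h.symm⟩ hxv
        ⟨hr.right, hsw, fun h => hrs' h.symm⟩ hr.ne.symm
      obtain rfl : q = r := (hr.sm q hB.de.symm.1).resolve_left
        (hB.rot.rot.rot.ne (hC.delGirth hC.girth s))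
      exact ⟨m, hB⟩
    obtain ⟨m₁, hB1⟩ := hB1
    obtain ⟨m₂, hB2⟩ := hB2
    have hm21 : m₂ ≠ m₁ := by
      rintro rfl
      exact tri m₂ r t hB2.cd.1 hrt hB1.cd.1.symm
    have hm2u : m₂ ≠ u := by
      rintro rfl
      exact hB2.cd.2.1 hu.right.symm
    have hm2v : m₂ ≠ v := (hB2.ne (hC.delGirth hC.girth s)).symm
    have hm1 : Sm (del H w') w m₁ t := by
      refine hB1.sbc.resolve_left fun h => ?_
      refine (h m₂ ⟨hB2.bc.1, hvw, fun h => ?_⟩).elim hm2u hm21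
      exact (sq m₂ w v w' hB2.bc.1.symm hv.left.symm hv.right h).elim hm2v hv.ne
    have hwt : w ≠ t := by
      rintro rfl
      exact hws ht.right.symm
    have hm1' : DegTwo H m₁ w t := by
      refine ⟨hwt, hB1.bc.1.symm, hB1.cd.1, fun y hy => ?_⟩
      by_cases hyw : H.Adj w' y
      · exfalso
        rcases hr.sm y hyw with rfl | rfl
        · rcases hv.sm m₁ hy.symm with e | e
          · exact H.irrefl (e ▸ hB1.bc.1)
          · exact hww (e ▸ hB1.bc.1)
        · exact tri y t m₁ hrt hB1.cd.1.symm hy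
      · exact hm1 y ⟨hy, hB1.cd.2.1, hyw⟩
    have hum1 : u ≠ m₁ := hB1.ne (hC.delGirth hC.girth w')
    obtain ⟨_, t', -, ht', -⟩ := hC.path_of_degTwo hu hm1' hum1
    have h1 := ht'.sm s ht.right.symm
    have h2 := ht'.sm r hrt.symm
    have h3 : s ≠ m₁ := fun e => hws (e ▸ hB1.bc.1)
    have h4 : r ≠ m₁ := fun e => hB1.cd.2.1 (e ▸ hr.right)
    exact hrs ((h2.resolve_left h4).trans (h1.resolve_left h3).symm)

/-- No degree-two vertex other than `v` lies at distance two from `v`. -/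
def Isol (H : SimpleGraph V) (v : V) : Prop :=
  ∀ u w s, DegTwo H u w s → H.Adj v w → u = v

omit [Finite V] in
lemma Crit.exists_bas {v w x y : V} (hv : Isol H v) (hvw : H.Adj v w) (hxv : x ≠ v)
    (hx : ¬ H.Adj v x) (hxy : H.Adj x y) : ∃ b c d e, Bas (del H v) x b c d e := by
  have sq := hC.girth.sq
  rcases hC.good v w hvw x with h | ⟨b, a, h, hxab⟩ | h
  · exfalso
    obtain ⟨z, hzy, hz⟩ := hC.noleaf x y hxy
    have h1 : H.Adj v y := by
      by_contra h'
      exact h y ⟨hxy, hx, h'⟩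
    have h2 : H.Adj v z := by
      by_contra h'
      exact h z ⟨hz, hx, h'⟩
    exact (sq x y v z hxy h1.symm h2 hz.symm).elim hxv hzy.symm
  · exfalso
    have hbv : b ≠ v := fun e => h.adj.2.2 (e ▸ h.adj.1)
    obtain ⟨z, hza, hz⟩ := hC.noleaf b a h.adj.1
    have hall : ∀ z, H.Adj b z → z ≠ a → H.Adj v z := by
      intro z hz hza
      by_contra h'
      exact hza (h.only z ⟨hz, h.adj.2.1, h'⟩)
    refine hbv (hv b z a ⟨hza, hz, h.adj.1, fun y hy => ?_⟩ (hall z hz hza))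
    by_contra! hne
    exact (sq b z v y hz (hall z hz hza).symm (hall y hy hne.2) hy.symm).elim hbv hne.1.symm
  · exact h

end Critical

section DegreeTwo
variable {V : Type} [Finite V] {H : SimpleGraph V}

/-- Two vertices `v`, `a₂` of degree two facing each other around the edge `a₄ a₅`. -/
structure TwoPentagons (H : SimpleGraph V) (v w w' a₁ a₂ a₃ a₄ a₅ : V) : Prop where
  hv : DegTwo H v w w'
  h₂ : DegTwo H a₂ a₁ a₃
  h₃₄ : H.Adj a₃ a₄
  h₄₅ : H.Adj a₄ a₅
  h₅₁ : H.Adj a₅ a₁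
  hw₄ : H.Adj w a₄
  hw₅ : H.Adj w' a₅
  hN₄ : ∀ y, H.Adj a₄ y → y = a₃ ∨ y = a₅ ∨ y = w
  hN₅ : ∀ y, H.Adj a₅ y → y = a₁ ∨ y = a₄ ∨ y = w'
  ne₃ : w ≠ a₃
  ne₁ : w' ≠ a₁

omit [Finite V] in
lemma TwoPentagons.refl {v w w' a₁ a₂ a₃ a₄ a₅ : V} (T : TwoPentagons H v w w' a₁ a₂ a₃ a₄ a₅) :
    TwoPentagons H v w' w a₃ a₂ a₁ a₅ a₄ :=
  ⟨T.hv.symm, T.h₂.symm, T.h₅₁.symm, T.h₄₅.symm, T.h₃₄.symm, T.hw₅, T.hw₄, T.hN₅, T.hN₄, T.ne₁,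
    T.ne₃⟩

omit [Finite V] in
lemma TwoPentagons.swap {v w w' a₁ a₂ a₃ a₄ a₅ : V} (T : TwoPentagons H v w w' a₁ a₂ a₃ a₄ a₅) :
    TwoPentagons H a₂ a₃ a₁ w' v w a₄ a₅ :=
  ⟨T.h₂.symm, T.hv.symm, T.hw₄, T.h₄₅, T.hw₅.symm, T.h₃₄, T.h₅₁.symm,
    fun y hy => by have := T.hN₄ y hy; tauto, fun y hy => by have := T.hN₅ y hy; tauto,
    T.ne₃.symm, T.ne₁.symm⟩

omit [Finite V] in
lemma degTwo_of_del {v w w' a p q : V} (hv : DegTwo H v w w') (hp : (del H v).Adj a p)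
    (hq : (del H v).Adj a q) (hpq : p ≠ q) (hs : Sm (del H v) p a q) (hw : ¬ H.Adj w a)
    (hw' : ¬ H.Adj w' a) : DegTwo H a p q := by
  refine ⟨hpq, hp.1, hq.1, fun y hy => hs y ⟨hy, hp.2.1, fun h => ?_⟩⟩
  rcases hv.sm y h with rfl | rfl
  · exact hw hy.symm
  · exact hw' hy.symm

variable (hC : Crit H)
include hC

lemma Crit.isol {v w w' : V} (hv : DegTwo H v w w') : Isol H v := by
  intro u w₀ s hu h
  rcases hv.sm _ h with rfl | rfl
  · exact hC.degTwo_unique hv hu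
  · exact hC.degTwo_unique hv.symm hu

lemma Crit.adj_outer {v w w' a₁ a₂ a₃ a₄ a₅ b y : V}
    (T : TwoPentagons H v w w' a₁ a₂ a₃ a₄ a₅) (hb : H.Adj a₁ b) (hb₂ : b ≠ a₂) (hb₅ : b ≠ a₅)
    (hy : H.Adj w y) (hyv : y ≠ v) (hy₄ : y ≠ a₄) : H.Adj b y := by
  have tri := hC.girth.tri
  have sq := hC.girth.sq
  have g' := hC.delGirth hC.girth b
  obtain ⟨hv, h₂, h₃₄, h₄₅, h₅₁, hw₄, hw₅, hN₄, hN₅, ne₃, ne₁⟩ := T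
  by_contra hby
  have h14 : a₁ ≠ a₄ := fun e => tri a₁ a₂ a₃ h₂.left.symm h₂.right (e ▸ h₃₄)
  have hba₂ : ¬ H.Adj b a₂ := fun h => tri b a₂ a₁ h h₂.left hb
  have hba₅ : ¬ H.Adj b a₅ := fun h => tri b a₅ a₁ h h₅₁ hb
  have hba₃ : ¬ H.Adj b a₃ := fun h =>
    (sq b a₁ a₂ a₃ hb.symm h₂.left.symm h₂.right h.symm).elim hb₂ h₂.ne
  have hba₄ : ¬ H.Adj b a₄ := fun h =>
    (sq b a₁ a₅ a₄ hb.symm h₅₁.symm h₄₅.symm h.symm).elim hb₅ h14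
  have hbw' : ¬ H.Adj b w' := fun h =>
    (sq b a₁ a₅ w' hb.symm h₅₁.symm hw₅.symm h.symm).elim hb₅ ne₁.symm
  have hbv : ¬ H.Adj b v := fun h => by
    rcases hv.sm b h.symm with rfl | rfl
    · rcases sq b a₄ a₅ a₁ hw₄ h₄₅ h₅₁ hb with e | e
      · exact hb₅ e
      · exact h14 e.symm
    · exact tri b a₅ a₁ hw₅ h₅₁ hb
  have hleaf : Leaf (del H b) a₂ a₃ := ⟨⟨h₂.right, hba₂, hba₃⟩, fun z hz =>
    (h₂.sm z hz.1).resolve_left fun e => hz.2.2 (e ▸ hb.symm)⟩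
  have h35 : a₃ ≠ a₅ := fun e => tri a₁ a₂ a₃ h₂.left.symm h₂.right (e ▸ h₅₁)
  have hv5 : v ≠ a₅ := fun e => by
    rcases hv.sm a₁ (e ▸ h₅₁) with h | h
    · rcases hv.sm a₄ (e ▸ h₄₅.symm) with h' | h'
      · exact h14 (h.trans h'.symm)
      · exact tri v w w' hv.left (h' ▸ hw₄) hv.right.symm
    · exact ne₁ h.symm
  have h4w : a₄ ≠ w' := fun e => tri v w w' hv.left (e ▸ hw₄) hv.right.symm
  obtain ⟨P, Q, hB⟩ := (hC.good b a₁ hb.symm a₅).bas g' (y := a₄) (y' := w') (z := a₃) (z' := v)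
    ⟨h₄₅.symm, hba₅, hba₄⟩ ⟨hw₅.symm, hba₅, hbw'⟩ h4w
    (fun z hz => (hN₅ z hz.1).resolve_left fun e => hz.2.2 (e ▸ hb.symm))
    ⟨h₃₄.symm, hba₄, hba₃⟩ h35 ⟨hv.right.symm, hbw', hbv⟩ hv5
  rcases hN₄ P hB.bc.1 with rfl | rfl | rfl
  · exact hB.rot.rot.not_leaf (hC.wc.del b) g' hleaf
  · exact hB.ne g' rfl
  · obtain rfl : Q = v := (sq P Q w' v hB.cd.1 hB.de.1 hv.right.symm hv.left).resolve_left hv.ne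
    have hsm : Sm (del H b) a₄ P Q := by
      refine hB.sbc.resolve_left fun h => ?_
      exact (h a₃ ⟨h₃₄.symm, hba₄, hba₃⟩).elim h35 ne₃.symm
    exact (hsm y ⟨hy, hB.bc.2.2, hby⟩).elim hy₄ hyv

omit [Finite V] in
lemma Crit.exists_outer_of {v w w' a₁ a₂ a₃ a₄ a₅ b : V}
    (T : TwoPentagons H v w w' a₁ a₂ a₃ a₄ a₅) (hb : H.Adj a₁ b) (hb₂ : b ≠ a₂) (hb₅ : b ≠ a₅) :
    ∃ b₁ b₃, H.Adj a₁ b₁ ∧ b₁ ≠ a₂ ∧ b₁ ≠ a₅ ∧ H.Adj a₃ b₃ ∧ b₃ ≠ a₂ ∧ b₃ ≠ a₄ ∧ H.Adj b₁ b₃ := by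
  have tri := hC.girth.tri
  have sq := hC.girth.sq
  have g' := hC.delGirth hC.girth w'
  obtain ⟨hv, h₂, h₃₄, h₄₅, h₅₁, hw₄, hw₅, hN₄, hN₅, ne₃, ne₁⟩ := T
  have h14 : a₁ ≠ a₄ := fun e => tri a₁ a₂ a₃ h₂.left.symm h₂.right (e ▸ h₃₄)
  have h35 : a₃ ≠ a₅ := fun e => tri a₁ a₂ a₃ h₂.left.symm h₂.right (e ▸ h₅₁)
  have h4w : a₄ ≠ w' := fun e => tri v w w' hv.left (e ▸ hw₄) hv.right.symm
  have hwb : ¬ H.Adj w' b := fun h =>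
    (sq w' b a₁ a₅ h hb.symm h₅₁.symm hw₅.symm).elim ne₁ hb₅
  have hw1 : ¬ H.Adj w' a₁ := fun h => tri w' a₅ a₁ hw₅ h₅₁ h.symm
  have hw4 : ¬ H.Adj w' a₄ := fun h => tri w' a₅ a₄ hw₅ h₄₅.symm h.symm
  have hw3 : ¬ H.Adj w' a₃ := fun h =>
    (sq w' a₅ a₄ a₃ hw₅ h₄₅.symm h₃₄.symm h.symm).elim h4w.symm h35.symm
  have hw2 : ¬ H.Adj w' a₂ := fun h => (h₂.sm w' h.symm).elim ne₁
    (fun e => hw4 (e ▸ h₃₄))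
  have h24 : a₂ ≠ a₄ := fun e => (h₂.sm a₅ (e ▸ h₄₅)).elim h₅₁.ne h35.symm
  obtain ⟨p, q, hB⟩ := (hC.good w' a₅ hw₅ a₂).bas g' (y := a₁) (y' := a₃) (z := b) (z' := a₄)
    ⟨h₂.left, hw2, hw1⟩ ⟨h₂.right, hw2, hw3⟩ h₂.ne (fun z hz => h₂.sm z hz.1) ⟨hb, hw1, hwb⟩ hb₂
    ⟨h₃₄, hw3, hw4⟩ h24.symm
  have hp5 : p ≠ a₅ := fun e => hB.bc.2.2 (e ▸ hw₅)
  refine ⟨p, q, hB.bc.1, (hB.ne g').symm, hp5, hB.de.1.symm, hB.rot.rot.rot.ne g', fun e => ?_,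
    hB.cd.1⟩
  exact (sq a₁ p a₄ a₅ hB.bc.1 (e ▸ hB.cd.1) h₄₅ h₅₁).elim h14 hp5

lemma Crit.exists_outer {v w w' a₁ a₂ a₃ a₄ a₅ : V}
    (T : TwoPentagons H v w w' a₁ a₂ a₃ a₄ a₅) :
    ∃ b₁ b₃, H.Adj a₁ b₁ ∧ b₁ ≠ a₂ ∧ b₁ ≠ a₅ ∧ H.Adj a₃ b₃ ∧ b₃ ≠ a₂ ∧ b₃ ≠ a₄ ∧ H.Adj b₁ b₃ := by
  have tri := hC.girth.tri
  have sq := hC.girth.sq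
  by_cases h1 : Sm H a₂ a₁ a₅
  · by_cases h3 : Sm H a₂ a₃ a₄
    · have h25 : a₂ ≠ a₅ := fun e => tri a₂ a₃ a₄ T.h₂.right T.h₃₄ (e ▸ T.h₄₅)
      have h24 : a₂ ≠ a₄ := fun e => tri a₁ a₂ a₅ T.h₂.left.symm (e ▸ T.h₄₅) T.h₅₁
      exact absurd (hC.degTwo_unique ⟨h24, T.h₂.right.symm, T.h₃₄, h3⟩
        ⟨h25, T.h₂.left.symm, T.h₅₁.symm, h1⟩) T.h₂.ne
    · simp only [Sm, not_forall, not_or] at h3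
      obtain ⟨b, hb, hb2, hb4⟩ := h3
      obtain ⟨b₃, b₁, hb₃, h₁, h₂, h₃, h₄, h₅, h₆⟩ := hC.exists_outer_of T.refl hb hb2 hb4
      exact ⟨b₁, b₃, h₃, h₄, h₅, hb₃, h₁, h₂, h₆.symm⟩
  · simp only [Sm, not_forall, not_or] at h1
    obtain ⟨b, hb, hb2, hb5⟩ := h1
    exact hC.exists_outer_of T hb hb2 hb5

lemma Crit.not_twoPentagons {v w w' a₁ a₂ a₃ a₄ a₅ : V} :
    ¬ TwoPentagons H v w w' a₁ a₂ a₃ a₄ a₅ := by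
  intro T
  have sq := hC.girth.sq
  obtain ⟨b₁, b₃, h₁, h₁₂, h₁₅, h₃, h₃₂, h₃₄, hb⟩ := hC.exists_outer T
  obtain ⟨y', y, hy', hy'v, hy'₅, hy, hyv, hy₄, hyy⟩ := hC.exists_outer T.swap
  have e₁ := hC.adj_outer T h₁ h₁₂ h₁₅ hy hyv hy₄
  have e₃ := hC.adj_outer T.refl h₃ h₃₂ h₃₄ hy' hy'v hy'₅
  rcases sq y b₁ b₃ y' e₁.symm hb e₃ hyy with rfl | rfl
  · exact (sq w y a₃ a₄ hy h₃.symm T.h₃₄ T.hw₄.symm).elim T.ne₃ h₃₄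
  · exact (sq a₁ b₁ w' a₅ h₁ hy'.symm T.hw₅ T.h₅₁).elim T.ne₁.symm h₁₅

lemma Crit.exists_far_degTwo {v w w' : V} (hv : DegTwo H v w w') :
    ∃ u p q, DegTwo H u p q ∧ u ≠ v ∧ ¬ H.Adj u v := by
  have tri := hC.girth.tri
  have sq := hC.girth.sq
  have g' := hC.delGirth hC.girth v
  obtain ⟨x, hxv, hx⟩ := hC.noleaf w v hv.left.symm
  obtain ⟨b, c, d, e, hB⟩ := hC.exists_bas (hC.isol hv) hv.left hxv
    (fun h => tri v w x hv.left hx h.symm) hx.symm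
  have nw : ∀ p, p ≠ x → (p = b ∨ p = c ∨ p = d ∨ p = e) → ¬ H.Adj w p := by
    rintro p hpx (rfl | rfl | rfl | rfl) h
    · exact tri w p x h hB.ab.1.symm hx.symm
    · rcases sq w p b x h hB.bc.1.symm hB.ab.1.symm hx.symm with e | e
      · exact hB.bc.2.1 (e ▸ hv.left)
      · exact hpx e
    · rcases sq w p e x h hB.de.1 hB.ea.1 hx.symm with e | e
      · exact hB.ea.2.1 (e ▸ hv.left)
      · exact hpx e
    · exact tri w p x h hB.ea.1 hx.symm
  have far : ∀ {u p q}, (u = b ∨ u = c ∨ u = d ∨ u = e) → u ≠ x → (del H v).Adj p u →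
      (del H v).Adj u q → p ≠ q → Sm (del H v) p u q → ¬ H.Adj w' u →
      ∃ u p q, DegTwo H u p q ∧ u ≠ v ∧ ¬ H.Adj u v := by
    intro u p q hu hux hp hq hpq hs h
    refine ⟨u, p, q, degTwo_of_del hv hp.symm hq hpq hs (nw u hux hu) h, ?_, fun h => hp.2.2 h.symm⟩
    rintro rfl
    exact hp.2.1 hp.1.symm
  have n1 := hB.ne g'
  have n2 := hB.rot.ne g'
  have n3 := hB.rot.rot.ne g'
  have n4 := hB.rot.rot.rot.ne g'
  have n5 := hB.rot.rot.rot.rot.ne g'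
  have nw' : ∀ p q r, (del H v).Adj p q → H.Adj q r → p ≠ r → ¬ (H.Adj w' p ∧ H.Adj w' r) := by
    rintro p q r hpq hqr hpr ⟨h1, h2⟩
    rcases sq w' p q r h1 hpq.1 hqr h2.symm with e | e
    · exact hpq.2.2 (e ▸ hv.right)
    · exact hpr e
  by_contra hcon
  have hit : ∀ {u p q}, (u = b ∨ u = c ∨ u = d ∨ u = e) → u ≠ x → (del H v).Adj p u →
      (del H v).Adj u q → p ≠ q → Sm (del H v) p u q → H.Adj w' u :=
    fun h h₁ h₂ h₃ h₄ h₅ => by_contra fun h₆ => hcon (far h h₁ h₂ h₃ h₄ h₅ h₆)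
  have fb := hit (.inl rfl) hB.ab.1.ne.symm hB.ab hB.bc n1
  have fc := hit (.inr (.inl rfl)) n1.symm hB.bc hB.cd n2
  have fd := hit (.inr (.inr (.inl rfl))) n4 hB.cd hB.de n3
  have fe := hit (.inr (.inr (.inr rfl))) hB.ea.1.ne hB.de hB.ea n4
  rcases hB.sbc with h₁ | h₁ <;> rcases hB.sde with h₂ | h₂
  · exact nw' b c d hB.bc hB.cd.1 n2 ⟨fb h₁, fd h₂⟩
  · exact nw' e x b hB.ea hB.ab.1 n5 ⟨fe h₂, fb h₁⟩
  · exact tri w' c d (fc h₁) hB.cd.1 (fd h₂).symm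
  · exact nw' c d e hB.cd hB.de.1 n3 ⟨fc h₁, fe h₂⟩

lemma Crit.exists_twoPaths {v w w' : V} (hv : DegTwo H v w w') :
    ∃ x x', H.Adj w x ∧ H.Adj x x' ∧ H.Adj x' w' ∧ x ≠ v ∧ x' ≠ v := by
  obtain ⟨u, p, q, hu, huv, huv'⟩ := hC.exists_far_degTwo hv
  have g' := hC.delGirth hC.girth u
  obtain ⟨b, c, d, e, hB⟩ := hC.exists_bas (hC.isol hu) hu.left huv.symm huv' hv.left
  have n1 := hB.ne g'
  have n5 := hB.rot.rot.rot.rot.ne g'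
  have n4 := hB.rot.rot.rot.ne g'
  rcases hv.sm b hB.ab.1 with rfl | rfl <;> rcases hv.sm e hB.ea.1.symm with rfl | rfl
  · exact absurd rfl n5
  · exact ⟨c, d, hB.bc.1, hB.cd.1, hB.de.1, n1.symm, n4⟩
  · exact ⟨d, c, hB.de.1.symm, hB.cd.1.symm, hB.bc.1.symm, n4, n1.symm⟩
  · exact absurd rfl n5

omit [Finite V] hC in
lemma bas_of_left {v w w' x b c d e : V} (hB : Bas (del H v) x b c d e) (hv : DegTwo H v w w')
    (hx' : H.Adj b w') : ¬ H.Adj x w' → ∀ y, H.Adj x y → Sm (del H v) e x b →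
      y = e ∨ y = b ∨ y = w := by
  intro hxw y hy hs
  by_cases hvy : H.Adj v y
  · rcases hv.sm y hvy with rfl | rfl
    · exact .inr (.inr rfl)
    · exact absurd hy hxw
  · have := hs y ⟨hy, hB.ab.2.1, hvy⟩
    tauto

/-- A small vertex of the pentagon next to the edge `x x'` forces its mirror image to be small. -/
lemma Crit.small_of_small {v w w' x x' c d e : V} (hv : DegTwo H v w w') (hwx : H.Adj w x)
    (hx'w : H.Adj x' w') (hB : Bas (del H v) x x' c d e) (hc : Sm (del H v) x' c d) :
    Sm (del H v) d e x := by
  have tri := hC.girth.tri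
  have sq := hC.girth.sq
  by_contra he
  have g := hC.delGirth hC.girth v
  have hx : Sm (del H v) e x x' := hB.sea.resolve_left he
  have hxw' : ¬ H.Adj x w' := fun h => tri x x' w' hB.ab.1 hx'w h.symm
  have hNx := bas_of_left hB hv hx'w hxw'
  have hwc : ¬ H.Adj w c := fun h => by
    rcases sq w x x' c hwx hB.ab.1 hB.bc.1 h.symm with e | e
    · exact hB.ab.2.2 (e ▸ hv.left)
    · exact hB.ne g e
  have hwc' : ¬ H.Adj w' c := fun h => tri w' c x' h hB.bc.1.symm hx'w
  have hwe : ¬ H.Adj e w' := fun h => by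
    rcases sq w' x' x e hx'w.symm hB.ab.1.symm hB.ea.1.symm h with e | e
    · exact hB.ab.2.1 (e ▸ hv.right)
    · exact hB.rot.rot.rot.rot.ne g e.symm
  have hcd : DegTwo H c x' d := degTwo_of_del hv hB.bc.symm hB.cd (hB.rot.ne g) hc hwc hwc'
  have g' := hC.delGirth hC.girth c
  have hcv : c ≠ v := fun h => hB.cd.2.2 (h ▸ hB.cd.1)
  have hxv : x ≠ v := fun h => hB.ab.2.2 (h ▸ hB.ab.1)
  have hcx : ¬ H.Adj c x := fun h =>
    (hcd.sm x h).elim hB.ab.1.ne (hB.rot.rot.rot.ne g).symm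
  obtain ⟨p₁, p₂, p₃, p₄, h1⟩ := hC.exists_bas (hC.isol hcd) hB.cd.1 hcv.symm
    (fun h => hB.cd.2.1 h.symm) hv.left
  obtain ⟨q₁, q₂, q₃, q₄, h2⟩ := hC.exists_bas (hC.isol hcd) hB.cd.1 (hB.ne g) hcx hB.ab.1
  have h1' : ∃ p q, Bas (del H c) v w p q w' := by
    rcases hv.sm _ h1.ab.1 with rfl | rfl <;> rcases hv.sm _ h1.ea.1.symm with rfl | rfl
    · exact absurd rfl (h1.rot.rot.rot.rot.ne g')
    · exact ⟨_, _, h1⟩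
    · exact ⟨_, _, h1.refl⟩
    · exact absurd rfl (h1.rot.rot.rot.rot.ne g')
  have hN : ∀ y, (del H c).Adj x y → y = e ∨ y = w := fun y hy => by
    rcases hNx y hy.1 hx with h | h | h
    · exact .inl h
    · exact absurd (h ▸ hB.bc.1.symm) hy.2.2
    · exact .inr h
  have h2' : ∃ p q, Bas (del H c) w x e p q := by
    rcases hN _ h2.ab with rfl | rfl <;> rcases hN _ h2.ea.symm with rfl | rfl
    · exact absurd rfl (h2.rot.rot.rot.rot.ne g')
    · exact ⟨_, _, h2.rot.rot.rot.rot⟩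
    · exact ⟨_, _, h2.rot.refl⟩
    · exact absurd rfl (h2.rot.rot.rot.rot.ne g')
  obtain ⟨p, q, h1⟩ := h1'
  obtain ⟨r, s, h2⟩ := h2'
  rcases h1.rot.share (hC.wc.del c) g' h2 with rfl | h
  · rcases hN q h1.cd with rfl | rfl
    · exact hwe h1.de.1
    · exact h1.rot.ne g' rfl
  · exact hxv h

lemma Crit.not_degTwo {v w w' : V} : ¬ DegTwo H v w w' := by
  intro hv
  have tri := hC.girth.tri
  have sq := hC.girth.sq
  have g := hC.delGirth hC.girth v
  obtain ⟨x, x', hwx, hxx, hx'w, hxv, hx'v⟩ := hC.exists_twoPaths hv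
  have hvx : ¬ H.Adj v x := fun h => tri v w x hv.left hwx h.symm
  have hvx' : ¬ H.Adj v x' := fun h => tri v w' x' hv.right hx'w.symm h.symm
  have hxw' : ¬ H.Adj x w' := fun h => tri x x' w' hxx hx'w h.symm
  have hx'w' : ¬ H.Adj x' w := fun h => tri w x x' hwx hxx h
  have hx : ∃ c d e, Bas (del H v) x x' c d e := by
    obtain ⟨b, c, d, e, hB⟩ := hC.exists_bas (hC.isol hv) hv.left hxv hvx hxx
    have hbe := hB.rot.rot.rot.rot.ne g
    by_cases hb : x' = b
    · subst hb
      exact ⟨_, _, _, hB⟩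
    by_cases he : x' = e
    · subst he
      exact ⟨_, _, _, hB.refl⟩
    exfalso
    have hns : ¬ Sm (del H v) e x b := fun h => (h x' ⟨hxx, hvx, hvx'⟩).elim he hb
    have key : ∀ z, (del H v).Adj x z → x' ≠ z → ¬ H.Adj w z ∧ ¬ H.Adj w' z := by
      refine fun z hz hne => ⟨fun h => tri w x z hwx hz.1 h.symm, fun h => ?_⟩
      rcases sq w' x' x z hx'w.symm hxx.symm hz.1 h.symm with e | e
      · exact hvx (e ▸ hv.right)
      · exact hne e
    have kb := key b hB.ab hb
    have ke := key e hB.ea.symm he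
    have d1 := degTwo_of_del hv hB.ab.symm hB.bc (hB.ne g) (hB.sab.resolve_left hns) kb.1 kb.2
    have d2 := degTwo_of_del hv hB.ea hB.de.symm (hB.rot.rot.rot.ne g).symm
      (hB.sea.resolve_right hns).symm ke.1 ke.2
    exact hbe (hC.degTwo_unique d1 d2)
  obtain ⟨c, d, e, hB⟩ := hx
  have hwd : ¬ H.Adj w d := fun h => by
    rcases sq w x e d hwx hB.ea.1.symm hB.de.1.symm h.symm with e | e
    · exact hB.ea.2.1 (e ▸ hv.left)
    · exact (hB.rot.rot.rot.ne g) e.symm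
  have hwd' : ¬ H.Adj w' d := fun h => by
    rcases sq w' x' c d hx'w.symm hB.bc.1 hB.cd.1 h.symm with e | e
    · exact hB.bc.2.2 (e ▸ hv.right)
    · exact hB.rot.ne g e
  have hwc : ¬ H.Adj w c := fun h => by
    rcases sq w x x' c hwx hB.ab.1 hB.bc.1 h.symm with e | e
    · exact hB.ab.2.2 (e ▸ hv.left)
    · exact hB.ne g e
  have hwc' : ¬ H.Adj w' c := fun h => tri w' c x' h hB.bc.1.symm hx'w
  have hwe' : ¬ H.Adj w' e := fun h => by
    rcases sq w' x' x e hx'w.symm hB.ab.1.symm hB.ea.1.symm h.symm with e | e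
    · exact hB.ab.2.1 (e ▸ hv.right)
    · exact hB.rot.rot.rot.rot.ne g e.symm
  have hwe : ¬ H.Adj w e := fun h => tri w x e hwx hB.ea.1.symm h.symm
  have hcs : ¬ Sm (del H v) x' c d := fun hc => by
    have he := hC.small_of_small hv hwx hx'w hB hc
    have d1 := degTwo_of_del hv hB.cd hB.bc.symm (hB.rot.ne g).symm hc.symm hwc hwc'
    have d2 := degTwo_of_del hv hB.de.symm hB.ea (hB.rot.rot.rot.ne g) he hwe hwe'
    exact hB.rot.rot.ne g (hC.degTwo_unique d2 d1)
  have hes : ¬ Sm (del H v) d e x := fun he =>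
    hcs (hC.small_of_small hv.symm hx'w.symm hwx.symm hB.rot.refl he.symm).symm
  have h5 := bas_of_left hB.rot.refl hv.symm hwx.symm hx'w'
  have h4 := bas_of_left hB hv hx'w hxw'
  refine hC.not_twoPentagons (v := v) (w := w) (w' := w') (a₁ := c) (a₂ := d) (a₃ := e) (a₄ := x)
    (a₅ := x') ⟨hv, degTwo_of_del hv hB.cd.symm hB.de (hB.rot.rot.ne g) (hB.scd.resolve_left hcs)
      hwd hwd', hB.ea.1, hxx, hB.bc.1, hwx, hx'w.symm,
      fun y hy => h4 y hy (hB.sea.resolve_left hes),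
      fun y hy => h5 y hy (hB.sbc.resolve_right hcs).symm, fun h => hB.ea.2.1 (h ▸ hv.left),
      fun h => hB.cd.2.1 (h ▸ hv.right)⟩

end DegreeTwo

section NoDegreeTwo
variable {V : Type} [Finite V] {H : SimpleGraph V}

/-- A basic five-cycle of `del H v`, three vertices of which have degree three in `H`, with one
neighbour each among the neighbours of `v`. -/
structure Pentagon (H : SimpleGraph V) (v w₂ w₄ w₅ a₁ a₂ a₃ a₄ a₅ : V) : Prop where
  hB : Bas (del H v) a₁ a₂ a₃ a₄ a₅
  hv₂ : H.Adj v w₂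
  hv₄ : H.Adj v w₄
  hv₅ : H.Adj v w₅
  hw₂ : H.Adj w₂ a₂
  hw₄ : H.Adj w₄ a₄
  hw₅ : H.Adj w₅ a₅
  hN₂ : ∀ y, H.Adj a₂ y → y = a₁ ∨ y = a₃ ∨ y = w₂
  hN₄ : ∀ y, H.Adj a₄ y → y = a₃ ∨ y = a₅ ∨ y = w₄
  hN₅ : ∀ y, H.Adj a₅ y → y = a₁ ∨ y = a₄ ∨ y = w₅

omit [Finite V] in
lemma Pentagon.refl {v w₂ w₄ w₅ a₁ a₂ a₃ a₄ a₅ : V} (T : Pentagon H v w₂ w₄ w₅ a₁ a₂ a₃ a₄ a₅) :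
    Pentagon H v w₂ w₅ w₄ a₃ a₂ a₁ a₅ a₄ :=
  ⟨T.hB.rot.rot.refl, T.hv₂, T.hv₅, T.hv₄, T.hw₂, T.hw₅, T.hw₄,
    fun y hy => by have := T.hN₂ y hy; tauto, T.hN₅, T.hN₄⟩

variable (hC : Crit H)
include hC

lemma Crit.pentagon_adj_outer {v w₂ w₄ w₅ a₁ a₂ a₃ a₄ a₅ b y : V}
    (T : Pentagon H v w₂ w₄ w₅ a₁ a₂ a₃ a₄ a₅) (hb : H.Adj a₁ b) (hb₂ : b ≠ a₂) (hb₅ : b ≠ a₅)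
    (hbv : ¬ H.Adj b v) (hy : H.Adj w₄ y) (hyv : y ≠ v) (hy₄ : y ≠ a₄) : H.Adj b y := by
  have tri := hC.girth.tri
  have sq := hC.girth.sq
  have g := hC.delGirth hC.girth v
  have g' := hC.delGirth hC.girth b
  obtain ⟨hB, hv₂, hv₄, hv₅, hw₂, hw₄, hw₅, hN₂, hN₄, hN₅⟩ := T
  by_contra hby
  have h14 : a₁ ≠ a₄ := (hB.rot.rot.rot.ne g).symm
  have h24 : a₂ ≠ a₄ := hB.rot.ne g
  have h35 : a₃ ≠ a₅ := hB.rot.rot.ne g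
  have hv1 : ∀ z, H.Adj v z → a₁ ≠ z := fun z hz e => hB.ab.2.1 (e ▸ hz)
  have hv3 : ∀ z, H.Adj v z → a₃ ≠ z := fun z hz e => hB.cd.2.1 (e ▸ hz)
  have hv4 : ∀ z, H.Adj v z → a₄ ≠ z := fun z hz e => hB.de.2.1 (e ▸ hz)
  have hv2' : v ≠ a₂ := fun e => hB.ab.2.1 (e ▸ hB.ab.1.symm)
  have hv5' : v ≠ a₅ := fun e => hB.ea.2.2 (e ▸ hB.ea.1)
  have hba₂ : ¬ H.Adj b a₂ := fun h => tri b a₂ a₁ h hB.ab.1.symm hb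
  have hba₅ : ¬ H.Adj b a₅ := fun h => tri b a₅ a₁ h hB.ea.1 hb
  have hba₃ : ¬ H.Adj b a₃ := fun h =>
    (sq b a₁ a₂ a₃ hb.symm hB.ab.1 hB.bc.1 h.symm).elim hb₂ (hB.ne g)
  have hba₄ : ¬ H.Adj b a₄ := fun h =>
    (sq b a₁ a₅ a₄ hb.symm hB.ea.1.symm hB.de.1.symm h.symm).elim hb₅ h14
  have hbw₂ : ¬ H.Adj b w₂ := fun h =>
    (sq b a₁ a₂ w₂ hb.symm hB.ab.1 hw₂.symm h.symm).elim hb₂ (hv1 _ hv₂)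
  have hbw₅ : ¬ H.Adj b w₅ := fun h =>
    (sq b a₁ a₅ w₅ hb.symm hB.ea.1.symm hw₅.symm h.symm).elim hb₅ (hv1 _ hv₅)
  obtain ⟨X, Y, h1⟩ := (hC.good b a₁ hb.symm a₂).bas g' (y := a₃) (y' := w₂) (z := a₄) (z' := v)
    ⟨hB.bc.1, hba₂, hba₃⟩ ⟨hw₂.symm, hba₂, hbw₂⟩ (hv3 _ hv₂)
    (fun z hz => (hN₂ z hz.1).resolve_left fun e => hz.2.2 (e ▸ hb.symm))
    ⟨hB.cd.1, hba₃, hba₄⟩ h24.symm ⟨hv₂.symm, hbw₂, hbv⟩ hv2'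
  obtain ⟨P, Q, h2⟩ := (hC.good b a₁ hb.symm a₅).bas g' (y := a₄) (y' := w₅) (z := a₃) (z' := v)
    ⟨hB.de.1.symm, hba₅, hba₄⟩ ⟨hw₅.symm, hba₅, hbw₅⟩ (hv4 _ hv₅)
    (fun z hz => (hN₅ z hz.1).resolve_left fun e => hz.2.2 (e ▸ hb.symm))
    ⟨hB.cd.1.symm, hba₄, hba₃⟩ h35 ⟨hv₅.symm, hbw₅, hbv⟩ hv5'
  rcases hN₄ P h2.bc.1 with rfl | rfl | rfl
  · rcases h1.rot.share (hC.wc.del b) g' h2.rot.rot.refl with rfl | e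
    · rcases hN₄ Y h1.cd.1 with rfl | rfl | rfl
      · exact h1.rot.ne g' rfl
      · exact (sq Y a₁ a₂ w₂ hB.ea.1 hB.ab.1 hw₂.symm h1.de.1.symm).elim
          (hB.rot.rot.rot.rot.ne g) (hv1 _ hv₂)
      · exact tri v Y w₂ hv₄ h1.de.1 hv₂.symm
    · exact h24 e.symm
  · exact h2.ne g' rfl
  · have h45 : P ≠ w₅ := h2.rot.rot.ne g'
    obtain rfl : Q = v := (sq P Q w₅ v h2.cd.1 h2.de.1 hv₅.symm hv₄).resolve_left h45
    have hsm : Sm (del H b) a₄ P Q := by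
      refine h2.sbc.resolve_left fun h => ?_
      exact (h a₃ ⟨hB.cd.1.symm, hba₄, hba₃⟩).elim h35 (hv3 _ hv₄)
    exact (hsm y ⟨hy, h2.bc.2.2, hby⟩).elim hy₄ hyv

omit [Finite V] in
lemma Crit.pentagon_exists_outer (hN : ∀ x a b, ¬ DegTwo H x a b)
    {v w₂ w₄ w₅ a₁ a₂ a₃ a₄ a₅ : V} (T : Pentagon H v w₂ w₄ w₅ a₁ a₂ a₃ a₄ a₅) :
    ∃ b y, H.Adj a₁ b ∧ b ≠ a₂ ∧ b ≠ a₅ ∧ H.Adj w₅ y ∧ y ≠ v ∧ y ≠ a₅ ∧ H.Adj b y := by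
  have tri := hC.girth.tri
  have sq := hC.girth.sq
  have g := hC.delGirth hC.girth v
  have g' := hC.delGirth hC.girth w₄
  obtain ⟨hB, hv₂, hv₄, hv₅, hw₂, hw₄, hw₅, hN₂, hN₄, hN₅⟩ := T
  have hv1 : ∀ z, H.Adj v z → a₁ ≠ z := fun z hz e => hB.ab.2.1 (e ▸ hz)
  have hv3 : ∀ z, H.Adj v z → a₃ ≠ z := fun z hz e => hB.cd.2.1 (e ▸ hz)
  have hv4 : ∀ z, H.Adj v z → a₄ ≠ z := fun z hz e => hB.de.2.1 (e ▸ hz)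
  have hv5 : ∀ z, H.Adj v z → a₅ ≠ z := fun z hz e => hB.ea.2.1 (e ▸ hz)
  have hv5' : v ≠ a₅ := fun e => hB.ea.2.2 (e ▸ hB.ea.1)
  have h45 : w₄ ≠ w₅ := fun e => tri w₄ a₄ a₅ hw₄ hB.de.1 (e ▸ hw₅.symm)
  obtain ⟨y, hy, hyv, hy₅⟩ : ∃ y, H.Adj w₅ y ∧ y ≠ v ∧ y ≠ a₅ := by
    by_contra! hcon
    exact hN w₅ v a₅ ⟨hv5', hv₅.symm, hw₅, fun y hy => or_iff_not_imp_left.mpr (hcon y hy)⟩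
  have hwy : ¬ H.Adj w₄ y := fun h =>
    (sq w₄ y w₅ v h hy.symm hv₅.symm hv₄).elim h45 hyv
  have hw5 : ¬ H.Adj w₄ w₅ := fun h => tri v w₄ w₅ hv₄ h hv₅.symm
  have hwa5 : ¬ H.Adj w₄ a₅ := fun h => tri w₄ a₄ a₅ hw₄ hB.de.1 h.symm
  have hwa1 : ¬ H.Adj w₄ a₁ := fun h =>
    (sq w₄ a₄ a₅ a₁ hw₄ hB.de.1 hB.ea.1 h.symm).elim (hv5 _ hv₄).symm (hB.rot.rot.rot.ne g)
  have hwa2 : ¬ H.Adj w₄ a₂ := fun h =>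
    (sq w₄ a₄ a₃ a₂ hw₄ hB.cd.1.symm hB.bc.1.symm h.symm).elim (hv3 _ hv₄).symm (hB.rot.ne g).symm
  obtain ⟨X, Y, h⟩ := (hC.good w₄ a₄ hw₄ a₅).bas g' (y := a₁) (y' := w₅) (z := a₂) (z' := y)
    ⟨hB.ea.1, hwa5, hwa1⟩ ⟨hw₅.symm, hwa5, hw5⟩ (hv1 _ hv₅)
    (fun z hz => (hN₅ z hz.1).imp_right fun h => h.resolve_left fun e => hz.2.2 (e ▸ hw₄))
    ⟨hB.ab.1, hwa1, hwa2⟩ (hB.rot.rot.rot.rot.ne g).symm ⟨hy, hw5, hwy⟩ hy₅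
  refine ⟨X, Y, h.bc.1, ?_, (h.ne g').symm, h.de.1.symm, fun e => h.cd.2.2 (e ▸ hv₄.symm),
    h.rot.rot.rot.ne g', h.cd.1⟩
  rintro rfl
  rcases hN₂ Y h.cd.1 with rfl | rfl | rfl
  · exact h.rot.ne g' rfl
  · exact (sq Y a₄ a₅ w₅ hB.cd.1 hB.de.1 hw₅.symm h.de.1.symm).elim (hB.rot.rot.ne g)
      (hv4 _ hv₅)
  · exact tri v Y w₅ hv₂ h.de.1 hv₅.symm

lemma Crit.not_pentagon (hN : ∀ x a b, ¬ DegTwo H x a b) {v w₂ w₄ w₅ a₁ a₂ a₃ a₄ a₅ : V} :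
    ¬ Pentagon H v w₂ w₄ w₅ a₁ a₂ a₃ a₄ a₅ := by
  intro T
  have tri := hC.girth.tri
  have sq := hC.girth.sq
  have g := hC.delGirth hC.girth v
  have hB := T.hB
  have h45 : w₄ ≠ w₅ := fun e => tri w₄ a₄ a₅ T.hw₄ hB.de.1 (e ▸ T.hw₅.symm)
  obtain ⟨b₁, y₅, hb₁, hb₁₂, hb₁₅, hy₅, hy₅v, hy₅₅, e₁⟩ := hC.pentagon_exists_outer hN T
  obtain ⟨b₃, y₄, hb₃, hb₃₂, hb₃₄, hy₄, hy₄v, hy₄₄, e₃⟩ := hC.pentagon_exists_outer hN T.refl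
  have n1 : ¬ H.Adj b₁ v := fun h => by
    rcases sq b₁ y₅ w₅ v e₁ hy₅.symm T.hv₅.symm h.symm with rfl | e
    · exact tri a₁ b₁ a₅ hb₁ T.hw₅ hB.ea.1
    · exact hy₅v e
  have n3 : ¬ H.Adj b₃ v := fun h => by
    rcases sq b₃ y₄ w₄ v e₃ hy₄.symm T.hv₄.symm h.symm with rfl | e
    · exact tri a₃ b₃ a₄ hb₃ T.hw₄ hB.cd.1.symm
    · exact hy₄v e
  have f₁ := hC.pentagon_adj_outer T hb₁ hb₁₂ hb₁₅ n1 hy₄ hy₄v hy₄₄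
  have f₃ := hC.pentagon_adj_outer T.refl hb₃ hb₃₂ hb₃₄ n3 hy₅ hy₅v hy₅₅
  rcases sq y₄ b₁ y₅ b₃ f₁.symm e₁ f₃.symm e₃ with rfl | rfl
  · exact (sq w₄ y₄ w₅ v hy₄ hy₅.symm T.hv₅.symm T.hv₄).elim h45 hy₄v
  · exact (sq a₁ b₁ a₃ a₂ hb₁ hb₃.symm hB.bc.1.symm hB.ab.1.symm).elim (hB.ne g) hb₁₂

lemma Crit.not_adj {v w : V} : ¬ H.Adj v w := by
  intro hvw
  have hN : ∀ x a b, ¬ DegTwo H x a b := fun x a b => hC.not_degTwo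
  have tri := hC.girth.tri
  have g := hC.delGirth hC.girth v
  obtain ⟨x, hxv, hwx⟩ := hC.noleaf w v hvw.symm
  obtain ⟨b, c, d, e, hB⟩ := hC.exists_bas (fun u w s h => absurd h (hN u w s)) hvw hxv
    (fun h => tri v w x hvw hwx h.symm) hwx.symm
  obtain ⟨a₁, a₂, a₃, a₄, a₅, hB, h₂, h₄, h₅, -⟩ := hB.exists_rot
  have key : ∀ p a q, (del H v).Adj p a → (del H v).Adj a q → p ≠ q → Sm (del H v) p a q →
      ∃ w, H.Adj v w ∧ H.Adj w a ∧ ∀ y, H.Adj a y → y = p ∨ y = q ∨ y = w := by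
    intro p a q hp hq hpq hs
    by_contra! hcon
    refine hN a p q ⟨hpq, hp.1.symm, hq.1, fun y hy => hs y ⟨hy, hp.2.2, fun hvy => ?_⟩⟩
    obtain ⟨z, hz, hzp, hzq, hzy⟩ := hcon y hvy hy.symm
    by_cases hvz : H.Adj v z
    · rcases hC.girth.sq v y a z hvy hy.symm hz hvz.symm with e | e
      · exact hp.2.1 (e ▸ hp.1.symm)
      · exact hzy e.symm
    · exact (hs z ⟨hz, hp.2.2, hvz⟩).elim hzp hzq
  obtain ⟨w₂, hv₂, hw₂, hN₂⟩ := key a₁ a₂ a₃ hB.ab hB.bc (hB.ne g) h₂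
  obtain ⟨w₄, hv₄, hw₄, hN₄⟩ := key a₃ a₄ a₅ hB.cd hB.de (hB.rot.rot.ne g) h₄
  obtain ⟨w₅, hv₅, hw₅, hN₅⟩ := key a₄ a₅ a₁ hB.de hB.ea (hB.rot.rot.rot.ne g) h₅
  exact hC.not_pentagon hN (v := v) (w₂ := w₂) (w₄ := w₄) (w₅ := w₅) ⟨hB, hv₂, hv₄, hv₅, hw₂, hw₄,
    hw₅, hN₂, hN₄, fun y hy => by have := hN₅ y hy; tauto⟩

end NoDegreeTwo

section Structure
variable {V : Type} [Finite V]

omit [Finite V] in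
lemma del_le (H : SimpleGraph V) (z : V) : del H z ≤ H := fun _ _ h => h.1

/-- Every vertex of a well-covered graph of girth at least five without induced seven-cycle links
is isolated, lies on a pendant edge, or lies on a basic five-cycle. -/
theorem good_of_noHeptagon {G : SimpleGraph V} (hW : WellCovered G) (hG : GirthFive G)
    (h7 : ∀ H, IsLink G H → NoHeptagon H) (x : V) : Good G x := by
  suffices h : ∀ H : SimpleGraph V, IsLink G H → WellCovered H → ∀ x, Good H x from
    h G (.refl G) hW x
  intro H
  induction H using WellFoundedLT.induction with
  | ind H ih =>
  intro hL hW x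
  have hG' : GirthFive H := hG.mono hL.le
  have good : ∀ z y, H.Adj z y → ∀ x, Good (del H z) x := fun z y hzy =>
    ih _ (del_lt hzy) (hL.del z) (hW.del z)
  by_cases hleaf : ∃ b a, Leaf H b a
  · obtain ⟨b, a, h⟩ := hleaf
    exact h.good_all hW hG' (good b a h.adj) x
  by_cases hbas : ∃ a b c d e, Bas H a b c d e
  · obtain ⟨a, b, c, d, e, h⟩ := hbas
    exact h.good_all hW hG' (fun u v y huy =>
      ih _ ((del_le _ v).trans_lt (del_lt huy)) ((hL.del u).del v) ((hW.del u).del v)) x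
  refine .inl fun y hxy => ?_
  have hC : Crit H := ⟨hW, hG', h7 H hL, good, fun u w huw => ?_, fun a b c d e h =>
    hbas ⟨a, b, c, d, e, h⟩⟩
  · exact hC.not_adj hxy
  · by_contra! hcon
    exact hleaf ⟨u, w, huw, fun z hz => by_contra fun hne => hcon z hne hz⟩

end Structure

section Exchange
variable {V : Type} [Finite V] {G : SimpleGraph V}

lemma Bas.sm_of_sm (hW : WellCovered G) (hG : GirthFive G) {a p r s q p' r' s' q' : V}
    (hB : Bas G a p r s q) (hB' : Bas G a p' r' s' q') (h : Sm G q' a p') : Sm G q a p := by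
  intro y hy
  rcases h y hy with rfl | rfl
  · exact (hB.share hW hG hB'.refl).symm
  · exact (hB.share hW hG hB').symm

omit [Finite V] in
lemma Leaf.not_bas (hG : GirthFive G) {b a c d e f : V} (h : Leaf G b a)
    (hB : Bas G b c d e f) : False :=
  hB.rot.rot.rot.rot.ne hG ((h.only f hB.ea.symm).trans (h.only c hB.ab).symm)

/-- A set of vertices such that listing it first gives a weakly polymatroidal ordering. -/
structure FrontSet (G : SimpleGraph V) (T : Set V) : Prop where
  stem : ∀ b a z, Leaf G b a → G.Adj a z → z ≠ b → a ∈ T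
  big : ∀ a b c d e, Bas G a b c d e → a ∉ T → Sm G e a b
  leaf : ∀ b a, Leaf G b a → (∃ z, G.Adj a z ∧ z ≠ b) → b ∉ T
  indep : ∀ a b c d e, Bas G a b c d e → a ∈ T → b ∉ T
  dense : ∀ a b c d e, Bas G a b c d e → a ∉ T → b ∈ T ∨ e ∈ T

lemma exists_frontSet (hW : WellCovered G) (hG : GirthFive G) : ∃ T, FrontSet G T := by
  let R (x : V) : Prop := ∃ b z, Leaf G b x ∧ G.Adj x z ∧ z ≠ b
  let P (T : Set V) : Prop := (∀ x ∈ T, R x ∨ ∃ b c d e, Bas G x b c d e) ∧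
    ∀ a b c d e, Bas G a b c d e → a ∈ T → b ∉ T
  let T₀ : Set V := {x | R x ∨ ∃ b c d e, Bas G x b c d e ∧ ¬ Sm G e x b}
  have hbig : ∀ {a b c d e}, Bas G a b c d e → a ∈ T₀ → ¬ Sm G e a b := by
    rintro a b c d e hB (⟨b', z, hb, -⟩ | ⟨b', c', d', e', hB', h⟩)
    · exact (hB.not_leaf hW hG hb).elim
    · exact fun h' => h (hB'.sm_of_sm hW hG hB h')
  have h₀ : P T₀ := by
    refine ⟨fun x hx => hx.imp_right fun ⟨b, c, d, e, h, _⟩ => ⟨b, c, d, e, h⟩,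
      fun a b c d e hB ha hb => ?_⟩
    exact hB.sab.elim (hbig hB ha) (hbig hB.rot hb)
  obtain ⟨T, hT₀, hT⟩ := (Set.toFinite {T | P T}).exists_le_maximal h₀
  refine ⟨T, fun b a z hb hz hzb => hT₀ (.inl ⟨b, z, hb, hz, hzb⟩), fun a b c d e hB ha => ?_,
    fun b a hb _ hbT => ?_, hT.prop.2, fun a b c d e hB ha => ?_⟩
  · by_contra h
    exact ha (hT₀ (.inr ⟨b, c, d, e, hB, h⟩))
  · rcases hT.prop.1 b hbT with ⟨b', z, hb', hz, hzb⟩ | ⟨c, d, e, f, hB⟩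
    · exact hzb ((hb.only z hz).trans (hb.only b' hb'.adj.symm).symm)
    · exact hb.not_bas hG hB
  · by_contra! hne
    have hP : P (insert a T) := by
      refine ⟨?_, fun x y z u t hB' hx hy => ?_⟩
      · rintro x (rfl | hx)
        · exact .inr ⟨_, _, _, _, hB⟩
        · exact hT.prop.1 x hx
      rcases hx with rfl | hx <;> rcases hy with rfl | hy
      · exact G.irrefl hB'.ab
      · rcases hB.share hW hG hB' with rfl | rfl
        exacts [hne.1 hy, hne.2 hy]
      · rcases hB.share hW hG hB'.rot.refl with rfl | rfl
        exacts [hne.1 hx, hne.2 hx]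
      · exact hT.prop.2 _ _ _ _ _ hB' hx hy
    exact ha (hT.le_of_ge hP (Set.subset_insert _ _) (Set.mem_insert _ _))

omit [Finite V] in
lemma FrontSet.exists_exchange [LinearOrder V] {T : Set V} (hT : FrontSet G T)
    (hG : ∀ x, Good G x) (hlt : ∀ p ∈ T, ∀ q ∉ T, p < q) {M N : Finset V} (hM : MaxIndep G M)
    (hN : MaxIndep G N) {q : V} (hqM : q ∈ M) (hqN : q ∉ N) (hMN : ∀ p < q, p ∈ M ↔ p ∈ N) :
    ∃ p, q < p ∧ G.Adj p q ∧ ∀ y ∈ M, G.Adj p y → y = q := by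
  have nM : ∀ {y}, G.Adj q y → y ∉ M := fun h hy => hM.1 q hqM _ hy h
  have after : ∀ {y}, G.Adj q y → y ∈ N → q < y := fun {y} h hy =>
    lt_of_le_of_ne (not_lt.mp fun hlt => nM h ((hMN y hlt).mpr hy)) h.ne
  obtain ⟨s, hsN, hqs⟩ := hN.2 q hqN
  by_cases hqT : q ∈ T
  · rcases hG q with h | ⟨b, a, h, hab⟩ | ⟨b, c, d, e, hB⟩
    · exact (h s hqs).elim
    · by_cases hz : ∃ z, G.Adj a z ∧ z ≠ b
      · rcases hab with rfl | rfl
        · exact ⟨b, hlt q hqT b (hT.leaf b q h hz), h.adj, fun y _ hy => h.only y hy⟩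
        · exact absurd hqT (hT.leaf q a h hz)
      · push Not at hz
        refine ⟨s, after hqs hsN, hqs.symm, fun y _ hy => ?_⟩
        rcases hab with rfl | rfl
        · obtain rfl := hz s hqs
          exact h.only y hy
        · obtain rfl := h.only s hqs
          exact hz y hy
    · have hb := hT.indep _ _ _ _ _ hB hqT
      have he := hT.indep _ _ _ _ _ hB.refl hqT
      by_cases hc : c ∈ M
      · have hd : d ∉ M := fun h => hM.1 c hc d h hB.cd
        refine ⟨e, hlt q hqT e he, hB.ea, fun y hy hey => ?_⟩
        exact (hT.big _ _ _ _ _ hB.rot.rot.rot.rot he y hey).resolve_left fun h => hd (h ▸ hy)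
      · refine ⟨b, hlt q hqT b hb, hB.ab.symm, fun y hy hby => ?_⟩
        exact (hT.big _ _ _ _ _ hB.rot hb y hby).resolve_right fun h => hc (h ▸ hy)
  · have hsq := after hqs hsN
    have hsT : s ∉ T := fun h => (hlt s h q hqT).not_gt hsq
    refine ⟨s, hsq, hqs.symm, fun y hy hsy => ?_⟩
    rcases hG q with h | ⟨b, a, h, hab⟩ | hB
    · exact (h s hqs).elim
    · have ha : a ∉ T := by
        rcases hab with rfl | rfl
        · exact hqT
        · exact h.only s hqs ▸ hsT
      have hz : ∀ z, G.Adj a z → z = b := fun z hz => by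
        by_contra hne
        exact ha (hT.stem b a z h hz hne)
      rcases hab with rfl | rfl
      · obtain rfl := hz s hqs
        exact h.only y hsy
      · obtain rfl := h.only s hqs
        exact hz y hsy
    · obtain ⟨b, c, d, e, hB, hb⟩ : ∃ b c d e, Bas G q b c d e ∧ b ∈ T := by
        obtain ⟨b, c, d, e, hB⟩ := hB
        rcases hT.dense _ _ _ _ _ hB hqT with h | h
        exacts [⟨_, _, _, _, hB, h⟩, ⟨_, _, _, _, hB.refl, h⟩]
      obtain rfl := (hT.big _ _ _ _ _ hB hqT s hqs).resolve_right fun h => hsT (h ▸ hb)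
      have hd := (hT.dense _ _ _ _ _ hB.rot.rot.rot.rot hsT).resolve_left hqT
      have hdM : d ∉ M := fun h => hN.1 s hsN d ((hMN d (hlt d hd q hqT)).mp h) hB.de.symm
      exact (hT.big _ _ _ _ _ hB.rot.rot.rot.rot hsT y hsy).resolve_left fun h => hdM (h ▸ hy)

lemma WellCovered.exchange [DecidableEq V] (hW : WellCovered G) {M : Finset V}
    (hM : MaxIndep G M) {p q : V} (hq : q ∈ M) (hpq : G.Adj p q)
    (hp : ∀ y ∈ M, G.Adj p y → y = q) : MaxIndep G (insert p (M.erase q)) := by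
  obtain ⟨k, hk⟩ := hW
  have hpM : p ∉ M := fun h => hM.1 p h q hq hpq
  have hind : indepCpx G (insert p (M.erase q)) := by
    refine indepCpx.insert (fun v hv w hw => hM.1 v (Finset.mem_of_mem_erase hv) w
      (Finset.mem_of_mem_erase hw)) fun t ht h => ?_
    exact Finset.ne_of_mem_erase ht (hp t (Finset.mem_of_mem_erase ht) h)
  obtain ⟨S, hS, hSM⟩ := exists_maxIndep hind
  have hcard : (insert p (M.erase q)).card = S.card := by
    rw [Finset.card_insert_of_notMem (fun h => hpM (Finset.mem_of_mem_erase h)),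
      Finset.card_erase_add_one hq, hk M hM, hk S hSM]
  rwa [Finset.eq_of_subset_of_card_le hS hcard.ge]

lemma exists_linearOrder_first (T : Set V) :
    ∃ r : LinearOrder V, ∀ p ∈ T, ∀ q ∉ T, r.lt p q := by
  classical
  have := Fintype.ofFinite V
  let e := Fintype.equivFin V
  let f : V → ℕ := fun x => if x ∈ T then e x else e x + Fintype.card V
  have hf : f.Injective := by
    intro x y h
    have hx := (e x).2
    have hy := (e y).2
    refine e.injective (Fin.ext ?_)
    simp only [f] at h
    split_ifs at h <;> omega
  refine ⟨LinearOrder.lift' f hf, fun p hp q hq => ?_⟩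
  change f p < f q
  have hp' := (e p).2
  simp only [f, hp, hq, if_true, if_false]
  omega

end Exchange

section CoverIdeal
variable {V : Type} {G : SimpleGraph V}

lemma girthFive_of_le_egirth (h : 5 ≤ G.egirth) : GirthFive G := by
  have key := SimpleGraph.le_egirth.mp h
  refine ⟨fun a b c hab hbc hca => ?_, fun a b c d hab hbc hcd hda => ?_⟩
  · have hc : (SimpleGraph.Walk.cons hab (.cons hbc (.cons hca .nil))).IsCycle := by
      rw [SimpleGraph.Walk.cons_isCycle_iff]
      simp [SimpleGraph.Walk.isPath_def, hab.ne, hab.ne.symm, hbc.ne, hca.ne, hca.ne.symm]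
    have := key a _ hc
    norm_num at this
  · by_contra! hne
    have hc : (SimpleGraph.Walk.cons hab (.cons hbc (.cons hcd (.cons hda .nil)))).IsCycle := by
      rw [SimpleGraph.Walk.cons_isCycle_iff]
      simp [SimpleGraph.Walk.isPath_def, hab.ne, hab.ne.symm, hbc.ne, hcd.ne, hda.ne,
        hda.ne.symm, hne.1, hne.1.symm, hne.2]
    have := key a _ hc
    norm_num at this

lemma isMinimalVertexCover_iff [Fintype V] [DecidableEq V] {F : Finset V} :
    IsMinimalVertexCover G F ↔ MaxIndep G Fᶜ := by
  have hcov : ∀ F : Finset V, IsVertexCover G F ↔ indepCpx G Fᶜ := fun F => by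
    refine ⟨fun h v hv w hw hvw => ?_, fun h v w hvw => ?_⟩
    · simp only [Finset.mem_compl] at hv hw
      exact (h v w hvw).elim hv hw
    · by_contra! hne
      exact h v (by simpa using hne.1) w (by simpa using hne.2) hvw
  refine ⟨fun h => ⟨(hcov F).mp h.1, fun v hv => ?_⟩,
    fun h => ⟨(hcov F).mpr h.1, fun F' hF' h' => ?_⟩⟩
  · by_contra! hne
    have hvF : v ∈ F := by simpa using hv
    have := h.2 (F.erase v) (Finset.erase_subset _ _) ((hcov _).mpr ?_)
    · rw [← this] at hvF
      exact Finset.notMem_erase v F hvF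
    · rw [Finset.compl_erase]
      exact ((hcov F).mp h.1).insert hne
  · refine Finset.Subset.antisymm hF' fun v hv => ?_
    by_contra hvF'
    obtain ⟨s, hs, hvs⟩ := h.2 v (by simpa using hv)
    rcases h' v s hvs with h | h
    · exact hvF' h
    · exact Finset.mem_compl.mp hs (hF' h)

lemma expOf_le_expOf {F F' : Finset V} : expOf F ≤ expOf F' ↔ F ⊆ F' := by
  classical
  refine ⟨fun h v hv => ?_, fun h v => ?_⟩
  · have := h v
    rw [expOf_apply, expOf_apply, if_pos hv] at this
    by_contra hv'
    simp [hv'] at this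
  · rw [expOf_apply, expOf_apply]
    by_cases hv : v ∈ F
    · rw [if_pos hv, if_pos (h hv)]
    · simp [hv]

variable {K : Type} [Field K]

lemma monomial_mem_coverIdeal {a : V →₀ ℕ} :
    monomial a (1 : K) ∈ coverIdeal K G ↔ ∃ F, IsMinimalVertexCover G F ∧ expOf F ≤ a := by
  have : {m : MvPolynomial V K | ∃ F : Finset V, IsMinimalVertexCover G F ∧ m = ∏ v ∈ F, X v} =
      (fun s => monomial s (1 : K)) '' {s | ∃ F, IsMinimalVertexCover G F ∧ s = expOf F} := by
    ext m
    simp [expOf, monomial_sum_one, X, eq_comm]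
  rw [coverIdeal, this, mem_ideal_span_monomial_image]
  classical
  simp [support_monomial]

lemma isMonoMinGen_coverIdeal {a : V →₀ ℕ} :
    IsMonoMinGen K (coverIdeal K G) a ↔ ∃ F, IsMinimalVertexCover G F ∧ a = expOf F := by
  constructor
  · rintro ⟨h, hmin⟩
    obtain ⟨F, hF, hle⟩ := monomial_mem_coverIdeal.mp h
    exact ⟨F, hF, (hmin _ (monomial_mem_coverIdeal.mpr ⟨F, hF, le_rfl⟩) hle).symm⟩
  · rintro ⟨F, hF, rfl⟩
    refine ⟨monomial_mem_coverIdeal.mpr ⟨F, hF, le_rfl⟩, fun b hb hle => ?_⟩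
    obtain ⟨F', hF', hle'⟩ := monomial_mem_coverIdeal.mp hb
    obtain rfl := hF.2 F' (expOf_le_expOf.mp (hle'.trans hle)) hF'.1
    exact le_antisymm hle hle'

lemma expOf_exchange [DecidableEq V] {F : Finset V} {p q : V} (hp : p ∈ F) (hq : q ∉ F) :
    expOf F + Finsupp.single q 1 - Finsupp.single p 1 = expOf (insert q (F.erase p)) := by
  ext v
  have hpq : p ≠ q := fun e => hq (e ▸ hp)
  simp only [Finsupp.tsub_apply, Finsupp.add_apply, expOf_apply, Finsupp.single_apply,
    Finset.mem_insert, Finset.mem_erase]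
  by_cases h1 : v = q
  · subst h1
    simp [hq, hpq]
  · by_cases h2 : v = p
    · subst h2
      simp [hp, h1, Ne.symm h1]
    · simp [h1, h2, Ne.symm h1, Ne.symm h2]

end CoverIdeal

theorem coverIdeal_weaklyPolymatroidal_of_girth_ge_five_CM
    (V : Type) [Fintype V] [DecidableEq V] (G : SimpleGraph V)
    (hgirth : 5 ≤ G.egirth)
    (hCM : IsCohenMacaulayQuot K (edgeIdeal K G)) :
    ∃ r : LinearOrder V, WeaklyPolymatroidalWrt K r.lt (coverIdeal K G) := by
  have hG := girthFive_of_le_egirth hgirth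
  obtain ⟨d, hd⟩ := exists_koszulCM hCM
  have hW : WellCovered G := ⟨d, fun S hS => hd.card_eq hS⟩
  have hgood := good_of_noHeptagon hW hG fun H hH => hd.noHeptagon_of_isLink hH
  obtain ⟨T, hT⟩ := exists_frontSet hW hG
  obtain ⟨r, hr⟩ := exists_linearOrder_first T
  refine ⟨r, fun a b ha hb q hab hq => ?_⟩
  obtain ⟨A, hA, rfl⟩ := isMonoMinGen_coverIdeal.mp ha
  obtain ⟨B, hB, rfl⟩ := isMonoMinGen_coverIdeal.mp hb
  simp only [expOf_apply] at hab hq ⊢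
  have hqA : q ∉ A := fun h => by simp [h] at hq; split_ifs at hq <;> omega
  have hqB : q ∈ B := by
    by_contra h
    simp [h] at hq
  have hM := isMinimalVertexCover_iff.mp hA
  obtain ⟨p, hqp, hpq, hp⟩ := hT.exists_exchange hgood hr hM (isMinimalVertexCover_iff.mp hB)
    (q := q) (by simpa using hqA) (by simpa using hqB) fun p hp => by
      have := hab p hp
      by_cases h : p ∈ A <;> by_cases h' : p ∈ B <;> simp_all
  have hpA : p ∈ A := by
    by_contra h
    exact hM.1 p (by simpa using h) q (by simpa using hqA) hpq
  refine ⟨p, hqp, by simp [hpA], ?_⟩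
  rw [expOf_exchange hpA hqA]
  refine isMonoMinGen_coverIdeal.mpr ⟨_, isMinimalVertexCover_iff.mpr ?_, rfl⟩
  convert hW.exchange hM (by simpa using hqA) hpq hp using 1
  ext v
  have hne := hpq.ne
  simp only [Finset.mem_compl, Finset.mem_insert, Finset.mem_erase]
  by_cases h1 : v = q <;> by_cases h2 : v = p <;> simp_all

end Stmt
end

section
/- Let ∇ be a simplicial co-complex on a finite set V with a partition V = V_1 ⊔ ··· ⊔ V_t, where V_i = {x_{i1},...,x_{ik_i}}, and let J be the face ideal of ∇ with respect to this partition in the polynomial ring K[x_{11},...,x_{tk_t}, y_1,...,y_t]. Then J^s is weakly polymatroidal for every s ≥ 1 in the ordering x_{11}>···>x_{1k_1}>···>x_{t1}>···>x_{tk_t}>y_1>···>y_t. -/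
/-!
STATEMENT 15: Let `∇` be a simplicial co-complex on a finite set `V` with partition
`V = V_1 ⊔ ⋯ ⊔ V_t`, `V_i = {x_{i1},…,x_{ik_i}}`, and let `J` be the face ideal of `∇`
with respect to this partition in `K[x_{11},…,x_{tk_t}, y_1,…,y_t]`.  Then `J^s` is
weakly polymatroidal for every `s ≥ 1` in the ordering
`x_{11} > ⋯ > x_{1k_1} > ⋯ > x_{t1} > ⋯ > x_{tk_t} > y_1 > ⋯ > y_t`.

The set `V` with its partition is modelled as `Σ i : Fin t, Fin (k i)`, the variables of
the polynomial ring by `(Σ i : Fin t, Fin (k i)) ⊕ Fin t` (the `y_i` corresponding to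
`Sum.inr i`), and the displayed ordering by the relation `varOrder` below.
-/

open MvPolynomial

namespace Stmt

variable (K : Type) [Field K]

/-- A simplicial co-complex: a collection of subsets of `V` closed under supersets. -/
def IsCoComplex {V : Type} (nabla : Finset V → Prop) : Prop :=
  ∀ F G : Finset V, nabla F → F ⊆ G → nabla G

/-- The generator `u_F = ∏_{x_{ij} ∈ F} x_{ij} · ∏_i y_i^{k_i - |F ∩ V_i|}` of the face
ideal associated to a face `F`. -/
noncomputable def faceMonomial (t : ℕ) (k : Fin t → ℕ)
    (F : Finset (Σ i : Fin t, Fin (k i))) :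
    MvPolynomial ((Σ i : Fin t, Fin (k i)) ⊕ Fin t) K :=
  (∏ v ∈ F, X (Sum.inl v)) *
    ∏ i : Fin t, (X (Sum.inr i) : MvPolynomial ((Σ i : Fin t, Fin (k i)) ⊕ Fin t) K) ^
      (k i - (F.filter fun v => v.1 = i).card)

/-- The face ideal `J = (u_F : F ∈ ∇)` of the co-complex `∇` with respect to the given
partition. -/
noncomputable def faceIdeal (t : ℕ) (k : Fin t → ℕ)
    (nabla : Finset (Σ i : Fin t, Fin (k i)) → Prop) :
    Ideal (MvPolynomial ((Σ i : Fin t, Fin (k i)) ⊕ Fin t) K) :=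
  Ideal.span { m | ∃ F, nabla F ∧ m = faceMonomial K t k F }

/-- The ordering `x_{11} > ⋯ > x_{1k_1} > ⋯ > x_{t1} > ⋯ > x_{tk_t} > y_1 > ⋯ > y_t`:
`varOrder a b` means that the variable `a` strictly precedes (is greater than) `b`. -/
def varOrder {t : ℕ} {k : Fin t → ℕ} :
    ((Σ i : Fin t, Fin (k i)) ⊕ Fin t) → ((Σ i : Fin t, Fin (k i)) ⊕ Fin t) → Prop :=
  fun a b =>
    match a, b with
    | Sum.inl v, Sum.inl w => v.1 < w.1 ∨ (v.1 = w.1 ∧ v.2.val < w.2.val)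
    | Sum.inl _, Sum.inr _ => True
    | Sum.inr _, Sum.inl _ => False
    | Sum.inr i, Sum.inr j => i < j

/-- The exponent vector of the generator `u_F`. -/
noncomputable def faceExponent (t : ℕ) (k : Fin t → ℕ) (F : Finset (Σ i : Fin t, Fin (k i))) :
    ((Σ i : Fin t, Fin (k i)) ⊕ Fin t) →₀ ℕ :=
  Finsupp.equivFunOnFinite.symm (Sum.elim (fun v => if v ∈ F then 1 else 0)
    (fun i => k i - (F.filter fun v => v.1 = i).card))

section

variable {t : ℕ} {k : Fin t → ℕ}

@[simp]
theorem faceExponent_inl (F : Finset (Σ i : Fin t, Fin (k i))) (v : Σ i : Fin t, Fin (k i)) :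
    faceExponent t k F (Sum.inl v) = if v ∈ F then 1 else 0 := by
  simp [faceExponent]

@[simp]
theorem faceExponent_inr (F : Finset (Σ i : Fin t, Fin (k i))) (i : Fin t) :
    faceExponent t k F (Sum.inr i) = k i - (F.filter fun v => v.1 = i).card := by
  simp [faceExponent]

theorem faceMonomial_eq_monomial (F : Finset (Σ i : Fin t, Fin (k i))) :
    faceMonomial K t k F = monomial (faceExponent t k F) 1 := by
  rw [monomial_eq, Finsupp.prod_fintype _ _ (by simp), Fintype.prod_sum_type]
  simp [faceMonomial, pow_ite, Finset.prod_ite_mem]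

theorem card_filter_fst_eq (F : Finset (Σ i : Fin t, Fin (k i))) (i : Fin t) :
    (F.filter fun v => v.1 = i).card = ∑ j : Fin (k i), if (⟨i, j⟩ : Σ i, Fin (k i)) ∈ F
      then 1 else 0 := by
  have h : (F.filter fun v => v.1 = i) =
      (Finset.univ.filter fun j : Fin (k i) => (⟨i, j⟩ : Σ i, Fin (k i)) ∈ F).map
        (Function.Embedding.sigmaMk i) := by
    ext ⟨i', j⟩
    simp only [Finset.mem_filter, Finset.mem_map, Finset.mem_univ, true_and,
      Function.Embedding.sigmaMk_apply]
    constructor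
    · rintro ⟨hF, rfl⟩
      exact ⟨j, hF, rfl⟩
    · rintro ⟨j', hF, h⟩
      exact ⟨h ▸ hF, (congrArg Sigma.fst h).symm⟩
  rw [h, Finset.card_map, Finset.card_filter]

theorem card_filter_fst_le (F : Finset (Σ i : Fin t, Fin (k i))) (i : Fin t) :
    (F.filter fun v => v.1 = i).card ≤ k i := by
  rw [card_filter_fst_eq, ← Finset.card_filter]
  simpa using Finset.card_le_univ
    (Finset.univ.filter fun j : Fin (k i) => (⟨i, j⟩ : Σ i, Fin (k i)) ∈ F)

theorem faceExponent_block (F : Finset (Σ i : Fin t, Fin (k i))) (i : Fin t) :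
    ∑ j : Fin (k i), faceExponent t k F (Sum.inl ⟨i, j⟩) + faceExponent t k F (Sum.inr i)
      = k i := by
  simp only [faceExponent_inl, faceExponent_inr, ← card_filter_fst_eq]
  have := card_filter_fst_le F i
  omega

/-- The exponent of `u_{F ∪ {v}}` is that of `u_F` with one `y_i` traded for `v ∈ V_i`. -/
theorem faceExponent_insert {F : Finset (Σ i : Fin t, Fin (k i))} {v : Σ i : Fin t, Fin (k i)}
    (hv : v ∉ F) :
    faceExponent t k (insert v F) + Finsupp.single (Sum.inr v.1) 1 =
      faceExponent t k F + Finsupp.single (Sum.inl v) 1 := by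
  ext (w | i)
  · by_cases hw : w = v
    · subst hw
      simp [hv]
    · simp [hw]
  · have hle := card_filter_fst_le (insert v F) i
    by_cases hi : v.1 = i
    · rw [Finset.filter_insert, if_pos hi, Finset.card_insert_of_notMem (by simp [hv])] at hle
      simp only [Finsupp.add_apply, faceExponent_inr, Finset.filter_insert, if_pos hi,
        Finset.card_insert_of_notMem (show v ∉ F.filter fun v => v.1 = i by simp [hv])]
      simp [hi]
      omega
    · simp [Finset.filter_insert, hi]

/-- The exponent vectors of products of `s` generators of the face ideal. -/
def facePowExponents (nabla : Finset (Σ i : Fin t, Fin (k i)) → Prop) (s : ℕ) :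
    Set (((Σ i : Fin t, Fin (k i)) ⊕ Fin t) →₀ ℕ) :=
  { a | ∃ F : Fin s → Finset (Σ i : Fin t, Fin (k i)), (∀ l, nabla (F l)) ∧
    a = ∑ l, faceExponent t k (F l) }

theorem faceIdeal_pow_eq_span (nabla : Finset (Σ i : Fin t, Fin (k i)) → Prop) (s : ℕ) :
    faceIdeal K t k nabla ^ s =
      Ideal.span ((fun a => monomial a (1 : K)) '' facePowExponents nabla s) := by
  rw [faceIdeal, Ideal.span, Submodule.span_pow, Ideal.span]
  congr 1
  ext m
  simp only [Set.mem_pow, facePowExponents, Set.mem_image, Set.mem_ofPred_eq, List.prod_ofFn]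
  constructor
  · rintro ⟨f, rfl⟩
    choose F hF hf using fun l => (f l).2
    refine ⟨_, ⟨F, hF, rfl⟩, ?_⟩
    simp [hf, faceMonomial_eq_monomial, monomial_sum_one]
  · rintro ⟨_, ⟨F, hF, rfl⟩, rfl⟩
    refine ⟨fun l => ⟨_, F l, hF l, rfl⟩, ?_⟩
    simp [faceMonomial_eq_monomial, monomial_sum_one]

variable {nabla : Finset (Σ i : Fin t, Fin (k i)) → Prop} {s : ℕ}
  {a b : ((Σ i : Fin t, Fin (k i)) ⊕ Fin t) →₀ ℕ}

theorem monomial_mem_faceIdeal_pow_iff :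
    monomial a (1 : K) ∈ faceIdeal K t k nabla ^ s ↔ ∃ c ∈ facePowExponents nabla s, c ≤ a := by
  rw [faceIdeal_pow_eq_span, mem_ideal_span_monomial_image]
  simp

theorem facePowExponents_block (ha : a ∈ facePowExponents nabla s) (i : Fin t) :
    ∑ j : Fin (k i), a (Sum.inl ⟨i, j⟩) + a (Sum.inr i) = s * k i := by
  obtain ⟨F, -, rfl⟩ := ha
  simp only [Finsupp.finsetSum_apply]
  rw [Finset.sum_comm, ← Finset.sum_add_distrib]
  simp only [faceExponent_block, Finset.sum_const, Finset.card_univ, Fintype.card_fin, smul_eq_mul]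

theorem eq_of_le_of_mem_facePowExponents (ha : a ∈ facePowExponents nabla s)
    (hb : b ∈ facePowExponents nabla s) (hab : a ≤ b) : a = b := by
  have key (i : Fin t) : (∀ j : Fin (k i), a (Sum.inl ⟨i, j⟩) = b (Sum.inl ⟨i, j⟩)) ∧
      a (Sum.inr i) = b (Sum.inr i) := by
    have h1 := facePowExponents_block ha i
    have h2 := facePowExponents_block hb i
    have h3 : ∀ j ∈ Finset.univ, a (Sum.inl ⟨i, j⟩) ≤ b (Sum.inl ⟨i, j⟩) := fun j _ => hab _
    have h4 := Finset.sum_le_sum h3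
    have h5 : a (Sum.inr i) ≤ b (Sum.inr i) := hab _
    refine ⟨fun j => (Finset.sum_eq_sum_iff_of_le h3).1 (by omega) j (Finset.mem_univ j), ?_⟩
    omega
  ext (⟨i, j⟩ | i)
  · exact (key i).1 j
  · exact (key i).2

theorem isMonoMinGen_faceIdeal_pow_iff :
    IsMonoMinGen K (faceIdeal K t k nabla ^ s) a ↔ a ∈ facePowExponents nabla s := by
  simp only [IsMonoMinGen, monomial_mem_faceIdeal_pow_iff]
  constructor
  · rintro ⟨⟨c, hc, hca⟩, hmin⟩
    exact hmin c ⟨c, hc, le_rfl⟩ hca ▸ hc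
  · refine fun ha => ⟨⟨a, ha, le_rfl⟩, ?_⟩
    rintro b ⟨c, hc, hcb⟩ hba
    exact le_antisymm hba (eq_of_le_of_mem_facePowExponents hc ha (hcb.trans hba) ▸ hcb)

theorem exists_exchange (hco : IsCoComplex nabla) (ha : a ∈ facePowExponents nabla s)
    {v : Σ i : Fin t, Fin (k i)} (hv : a (Sum.inl v) < s) :
    ∃ c ∈ facePowExponents nabla s,
      c + Finsupp.single (Sum.inr v.1) 1 = a + Finsupp.single (Sum.inl v) 1 := by
  obtain ⟨F, hF, rfl⟩ := ha
  obtain ⟨l, hl⟩ : ∃ l, v ∉ F l := by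
    by_contra! h
    simp [Finsupp.finsetSum_apply, h] at hv
  refine ⟨_, ⟨Function.update F l (insert v (F l)), fun m => ?_, rfl⟩, ?_⟩
  · by_cases hm : m = l
    · subst hm
      simpa using hco _ _ (hF m) (Finset.subset_insert _ _)
    · simpa [hm] using hF m
  · have h : ∀ m ∈ Finset.univ.erase l, faceExponent t k (Function.update F l (insert v (F l)) m) =
        faceExponent t k (F m) := fun m hm => by simp [Finset.ne_of_mem_erase hm]
    rw [← Finset.sum_erase_add _ _ (Finset.mem_univ l), Finset.sum_congr rfl h, add_assoc,
      Function.update_self, faceExponent_insert hl, ← add_assoc,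
      Finset.sum_erase_add _ _ (Finset.mem_univ l)]

theorem apply_inl_le_of_mem_facePowExponents (ha : a ∈ facePowExponents nabla s)
    (v : Σ i : Fin t, Fin (k i)) : a (Sum.inl v) ≤ s := by
  obtain ⟨F, -, rfl⟩ := ha
  simp only [Finsupp.finsetSum_apply, faceExponent_inl, ← Finset.card_filter]
  simpa using Finset.card_le_univ (Finset.univ.filter fun l => v ∈ F l)

end

theorem faceIdeal_pow_weaklyPolymatroidal
    (t : ℕ) (k : Fin t → ℕ) (hk : ∀ i, 1 ≤ k i)
    (nabla : Finset (Σ i : Fin t, Fin (k i)) → Prop)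
    (hco : IsCoComplex nabla) (s : ℕ) (hs : 1 ≤ s) :
    WeaklyPolymatroidalWrt K varOrder (faceIdeal K t k nabla ^ s) := by
  intro a b ha hb q hlt hq
  rw [isMonoMinGen_faceIdeal_pow_iff] at ha hb
  obtain v | i := q
  · obtain ⟨c, hc, hca⟩ := exists_exchange hco ha
      (hq.trans_le (apply_inl_le_of_mem_facePowExponents hb v))
    refine ⟨Sum.inr v.1, trivial, ?_, ?_⟩
    · have := DFunLike.congr_fun hca (Sum.inr v.1)
      simp at this
      omega
    · rw [isMonoMinGen_faceIdeal_pow_iff, ← hca, add_tsub_cancel_right]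
      exact hc
  · have h1 := facePowExponents_block ha i
    have h2 := facePowExponents_block hb i
    have h3 : ∑ j : Fin (k i), a (Sum.inl ⟨i, j⟩) = ∑ j : Fin (k i), b (Sum.inl ⟨i, j⟩) :=
      Finset.sum_congr rfl fun j _ => hlt _ trivial
    omega

end Stmt
end

section
/- Let ∇ be a simplicial co-complex on [n] such that for every i ∈ [n] there exist F, G ∈ ∇ with F ∪ G = [n] and F ∩ G = {i}. Let J be the face ideal of ∇ with respect to the trivial partition (every part a singleton), in K[x_1,...,x_n,y_1,...,y_n]. For positive integers s, t with 2t ≤ s, the ideal L_{s,t} = J^s + (x_1···x_n y_1···y_n)J^{s−2} + (x_1···x_n y_1···y_n)^2 J^{s−4} + ··· + (x_1···x_n y_1···y_n)^t J^{s−2t} is weakly polymatroidal in the ordering x_1>···>x_n>y_1>···>y_n. -/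
/-!
STATEMENT 18: Let `∇` be a simplicial co-complex on `[n]` such that for every `i ∈ [n]`
there exist `F, G ∈ ∇` with `F ∪ G = [n]` and `F ∩ G = {i}`.  Let `J` be the face ideal
of `∇` with respect to the trivial partition, in `K[x_1,…,x_n,y_1,…,y_n]`.  For positive
integers `s, t` with `2t ≤ s`, the ideal
`L_{s,t} = J^s + (x_{[n]}y_{[n]}) J^{s-2} + (x_{[n]}y_{[n]})² J^{s-4} + ⋯ + (x_{[n]}y_{[n]})^t J^{s-2t}`
is weakly polymatroidal in the ordering `x_1 > ⋯ > x_n > y_1 > ⋯ > y_n`.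

The variables are indexed by `Fin n ⊕ Fin n`, the `x_i` by `Sum.inl i` and the `y_i` by
`Sum.inr i`; the displayed ordering is the relation `xyOrder` below.
-/

open MvPolynomial

namespace Stmt

variable (K : Type) [Field K]

/-- The generator `u_F = ∏_{i ∈ F} x_i · ∏_{i ∉ F} y_i` of the face ideal of `∇` with
respect to the trivial partition. -/
noncomputable def trivFaceMonomial (n : ℕ) (F : Finset (Fin n)) :
    MvPolynomial (Fin n ⊕ Fin n) K :=
  (∏ i ∈ F, X (Sum.inl i)) * ∏ i ∈ Fᶜ, X (Sum.inr i)

/-- The face ideal `J = (u_F : F ∈ ∇)` of `∇` with respect to the trivial partition. -/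
noncomputable def trivFaceIdeal (n : ℕ) (nabla : Finset (Fin n) → Prop) :
    Ideal (MvPolynomial (Fin n ⊕ Fin n) K) :=
  Ideal.span { m | ∃ F, nabla F ∧ m = trivFaceMonomial K n F }

/-- The monomial `x_{[n]} y_{[n]} = x_1 ⋯ x_n y_1 ⋯ y_n`. -/
noncomputable def allVarsProd (n : ℕ) : MvPolynomial (Fin n ⊕ Fin n) K :=
  ∏ i : Fin n, (X (Sum.inl i) * X (Sum.inr i))

/-- The ideal `L_{s,t} = Σ_{a=0}^{t} (x_{[n]} y_{[n]})^a J^{s-2a}`. -/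
noncomputable def Lst (n : ℕ) (nabla : Finset (Fin n) → Prop) (s t : ℕ) :
    Ideal (MvPolynomial (Fin n ⊕ Fin n) K) :=
  ∑ a ∈ Finset.range (t + 1),
    Ideal.span {allVarsProd K n} ^ a * trivFaceIdeal K n nabla ^ (s - 2 * a)

/-- The ordering `x_1 > ⋯ > x_n > y_1 > ⋯ > y_n`:  `xyOrder a b` means that the
variable `a` strictly precedes (is greater than) `b`. -/
def xyOrder {n : ℕ} : (Fin n ⊕ Fin n) → (Fin n ⊕ Fin n) → Prop :=
  fun a b =>
    match a, b with
    | Sum.inl i, Sum.inl j => i < j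
    | Sum.inl _, Sum.inr _ => True
    | Sum.inr _, Sum.inl _ => False
    | Sum.inr i, Sum.inr j => i < j

/-- The exponent vector of `u_F`. -/
noncomputable def faceExp {n : ℕ} (F : Finset (Fin n)) : (Fin n ⊕ Fin n) →₀ ℕ :=
  Finsupp.equivFunOnFinite.symm
    (Sum.elim (fun i => if i ∈ F then 1 else 0) (fun i => if i ∈ F then 0 else 1))

/-- The exponent vector of `x_{[n]} y_{[n]}`. -/
noncomputable def onesExp (n : ℕ) : (Fin n ⊕ Fin n) →₀ ℕ :=
  Finsupp.equivFunOnFinite.symm fun _ => 1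

/-- `IsFaceSum nabla k e` says that `e` is the exponent vector of a product of `k` monomials
`u_F` with `F ∈ ∇`. -/
inductive IsFaceSum {n : ℕ} (nabla : Finset (Fin n) → Prop) :
    ℕ → ((Fin n ⊕ Fin n) →₀ ℕ) → Prop
  | zero : IsFaceSum nabla 0 0
  | succ {k : ℕ} {e : (Fin n ⊕ Fin n) →₀ ℕ} {F : Finset (Fin n)} :
      IsFaceSum nabla k e → nabla F → IsFaceSum nabla (k + 1) (e + faceExp F)

/-- The exponent vectors of the generators of `L_{s,t}`. -/
def lstExps {n : ℕ} (nabla : Finset (Fin n) → Prop) (s t : ℕ) :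
    Set ((Fin n ⊕ Fin n) →₀ ℕ) :=
  { d | ∃ a ≤ t, ∃ e, IsFaceSum nabla (s - 2 * a) e ∧ d = a • onesExp n + e }

@[simp]
lemma faceExp_inl {n : ℕ} (F : Finset (Fin n)) (i : Fin n) :
    faceExp F (Sum.inl i) = if i ∈ F then 1 else 0 := rfl

@[simp]
lemma faceExp_inr {n : ℕ} (F : Finset (Fin n)) (i : Fin n) :
    faceExp F (Sum.inr i) = if i ∈ F then 0 else 1 := rfl

@[simp]
lemma onesExp_apply {n : ℕ} (p : Fin n ⊕ Fin n) : onesExp n p = 1 := rfl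

section Generators

variable {n : ℕ} (nabla : Finset (Fin n) → Prop)

lemma trivFaceMonomial_eq_monomial (F : Finset (Fin n)) :
    trivFaceMonomial K n F = monomial (faceExp F) 1 := by
  rw [monomial_eq, Finsupp.prod_fintype _ _ (by simp), Fintype.prod_sum_type]
  simp [trivFaceMonomial, pow_ite, Finset.prod_ite,
    Finset.compl_eq_univ_sdiff, Finset.sdiff_eq_filter]

lemma allVarsProd_pow_eq_monomial (a : ℕ) :
    allVarsProd K n ^ a = monomial (a • onesExp n) 1 := by
  have h : allVarsProd K n = monomial (onesExp n) 1 := by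
    rw [monomial_eq, Finsupp.prod_fintype _ _ (by simp), Fintype.prod_sum_type]
    simp [allVarsProd, Finset.prod_mul_distrib]
  rw [h, monomial_pow, one_pow]

lemma trivFaceIdeal_pow (k : ℕ) :
    trivFaceIdeal K n nabla ^ k =
      Ideal.span ((fun e => monomial e (1 : K)) '' { e | IsFaceSum nabla k e }) := by
  induction k with
  | zero =>
    rw [pow_zero, eq_comm, Ideal.one_eq_top, Ideal.eq_top_iff_one]
    exact Ideal.subset_span ⟨0, .zero, rfl⟩
  | succ k ih =>
    rw [pow_succ, ih, trivFaceIdeal, Ideal.span_mul_span']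
    congr 1
    ext m
    simp only [Set.mem_mul, Set.mem_image, Set.mem_ofPred_eq]
    constructor
    · rintro ⟨_, ⟨e, he, rfl⟩, _, ⟨F, hF, rfl⟩, rfl⟩
      exact ⟨_, he.succ hF, by simp [trivFaceMonomial_eq_monomial, monomial_mul]⟩
    · rintro ⟨_, h, rfl⟩
      obtain @⟨⟩ | @⟨_, e, F, he, hF⟩ := h
      exact ⟨_, ⟨_, he, rfl⟩, _, ⟨_, hF, rfl⟩,
        by simp [trivFaceMonomial_eq_monomial, monomial_mul]⟩

lemma Lst_eq_span (s t : ℕ) :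
    Lst K n nabla s t = Ideal.span ((fun e => monomial e (1 : K)) '' lstExps nabla s t) := by
  have h (a : ℕ) : Ideal.span {allVarsProd K n} ^ a * trivFaceIdeal K n nabla ^ (s - 2 * a) =
      Ideal.span ((fun e => monomial (a • onesExp n + e) (1 : K)) ''
        { e | IsFaceSum nabla (s - 2 * a) e }) := by
    rw [Ideal.span_singleton_pow, trivFaceIdeal_pow, Ideal.span_mul_span',
      allVarsProd_pow_eq_monomial, Set.singleton_mul, Set.image_image]
    simp [monomial_mul]
  rw [Lst, Ideal.sum_eq_sup, Finset.sup_eq_iSup]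
  simp_rw [h]
  simp only [← Ideal.span_iUnion]
  congr 1
  ext m
  simp only [Set.mem_iUnion, Set.mem_image, Set.mem_ofPred_eq, Finset.mem_range, Nat.lt_succ_iff,
    lstExps]
  constructor
  · rintro ⟨a, ha, e, he, rfl⟩
    exact ⟨_, ⟨a, ha, e, he, rfl⟩, rfl⟩
  · rintro ⟨_, ⟨a, ha, e, he, rfl⟩, rfl⟩
    exact ⟨a, ha, e, he, rfl⟩

lemma monomial_mem_Lst_iff (s t : ℕ) (e : (Fin n ⊕ Fin n) →₀ ℕ) :
    monomial e (1 : K) ∈ Lst K n nabla s t ↔ ∃ d ∈ lstExps nabla s t, d ≤ e := by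
  rw [Lst_eq_span, mem_ideal_span_monomial_image]
  simp

variable {nabla}

lemma IsFaceSum.inl_add_inr {k : ℕ} {e : (Fin n ⊕ Fin n) →₀ ℕ} (h : IsFaceSum nabla k e)
    (i : Fin n) : e (Sum.inl i) + e (Sum.inr i) = k := by
  induction h with
  | zero => simp
  | succ _ _ ih =>
    simp only [Finsupp.add_apply, faceExp_inl, faceExp_inr]
    split_ifs <;> omega

lemma inl_add_inr_of_mem_lstExps {s t : ℕ} (hts : 2 * t ≤ s) {d : (Fin n ⊕ Fin n) →₀ ℕ}
    (h : d ∈ lstExps nabla s t) (i : Fin n) : d (Sum.inl i) + d (Sum.inr i) = s := by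
  obtain ⟨a, ha, e, he, rfl⟩ := h
  have := he.inl_add_inr i
  simp
  omega

/-- All generators of `L_{s,t}` have the same degree, so each of them is minimal. -/
lemma isMonoMinGen_Lst_iff {s t : ℕ} (hts : 2 * t ≤ s) (e : (Fin n ⊕ Fin n) →₀ ℕ) :
    IsMonoMinGen K (Lst K n nabla s t) e ↔ e ∈ lstExps nabla s t := by
  constructor
  · rintro ⟨h, hmin⟩
    obtain ⟨d, hd, hde⟩ := (monomial_mem_Lst_iff K nabla s t e).1 h
    rw [← hmin d ((monomial_mem_Lst_iff K nabla s t d).2 ⟨d, hd, le_rfl⟩) hde]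
    exact hd
  · intro he
    refine ⟨(monomial_mem_Lst_iff K nabla s t e).2 ⟨e, he, le_rfl⟩, fun b hb hbe => ?_⟩
    obtain ⟨d, hd, hdb⟩ := (monomial_mem_Lst_iff K nabla s t b).1 hb
    ext p
    obtain ⟨i, hp⟩ : ∃ i, p = Sum.inl i ∨ p = Sum.inr i := by cases p <;> simp
    have h1 := inl_add_inr_of_mem_lstExps hts hd i
    have h2 := inl_add_inr_of_mem_lstExps hts he i
    have h3 := hdb (Sum.inl i)
    have h4 := hdb (Sum.inr i)
    have h5 := hbe (Sum.inl i)
    have h6 := hbe (Sum.inr i)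
    rcases hp with rfl | rfl <;> omega

lemma faceExp_insert {F : Finset (Fin n)} {i : Fin n} (hi : i ∉ F) :
    faceExp (insert i F) + Finsupp.single (Sum.inr i) 1 =
      faceExp F + Finsupp.single (Sum.inl i) 1 := by
  ext p
  rcases p with j | j <;> rcases eq_or_ne j i with rfl | hj <;> simp [*]

lemma faceExp_add_faceExp {F G : Finset (Fin n)} {i : Fin n} (hU : F ∪ G = Finset.univ)
    (hI : F ∩ G = {i}) :
    faceExp F + faceExp G + Finsupp.single (Sum.inr i) 1 =
      onesExp n + Finsupp.single (Sum.inl i) 1 := by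
  ext p
  have h1 (j : Fin n) : j ∈ F ∨ j ∈ G := by simp [← Finset.mem_union, hU]
  have h2 (j : Fin n) : j ∈ F ∧ j ∈ G ↔ j = i := by
    rw [← Finset.mem_inter, hI, Finset.mem_singleton]
  rcases p with j | j <;> have h1 := h1 j <;> have h2 := h2 j <;>
    by_cases hF : j ∈ F <;> by_cases hG : j ∈ G <;>
    simp_all [eq_comm]

lemma IsFaceSum.exists_exchange (hco : IsCoComplex nabla) {k : ℕ} {e : (Fin n ⊕ Fin n) →₀ ℕ}
    (h : IsFaceSum nabla k e) {i : Fin n} (hi : e (Sum.inl i) < k) :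
    ∃ e', IsFaceSum nabla k e' ∧
      e' + Finsupp.single (Sum.inr i) 1 = e + Finsupp.single (Sum.inl i) 1 := by
  induction h with
  | zero => simp at hi
  | @succ k e F he hF ih =>
    by_cases hiF : i ∈ F
    · obtain ⟨e', he', heq⟩ := ih (by simpa [hiF] using hi)
      exact ⟨_, he'.succ hF, by rw [add_right_comm, heq, add_right_comm]⟩
    · exact ⟨_, he.succ (hco F (insert i F) hF (Finset.subset_insert i F)),
        by rw [add_assoc, faceExp_insert hiF, add_assoc]⟩

lemma exists_exchange_of_mem_lstExps (hco : IsCoComplex nabla)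
    (hcover : ∀ i : Fin n, ∃ F G : Finset (Fin n), nabla F ∧ nabla G ∧
      F ∪ G = Finset.univ ∧ F ∩ G = {i})
    {s t : ℕ} (hts : 2 * t ≤ s) {d : (Fin n ⊕ Fin n) →₀ ℕ} (hd : d ∈ lstExps nabla s t)
    {i : Fin n} (hi : d (Sum.inl i) < s) :
    ∃ d' ∈ lstExps nabla s t,
      d' + Finsupp.single (Sum.inr i) 1 = d + Finsupp.single (Sum.inl i) 1 := by
  obtain ⟨a, ha, e, he, rfl⟩ := hd
  by_cases hei : e (Sum.inl i) < s - 2 * a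
  · obtain ⟨e', he', heq⟩ := he.exists_exchange hco hei
    exact ⟨_, ⟨a, ha, e', he', rfl⟩, by rw [add_assoc, heq, add_assoc]⟩
  · cases a with
    | zero => simp at hi hei; omega
    | succ a =>
      obtain ⟨F, G, hF, hG, hU, hI⟩ := hcover i
      have hk : s - 2 * (a + 1) + 1 + 1 = s - 2 * a := by omega
      refine ⟨_, ⟨a, by omega, _, hk ▸ (he.succ hF).succ hG, rfl⟩, ?_⟩
      rw [succ_nsmul, add_assoc e, ← add_assoc, add_assoc, faceExp_add_faceExp hU hI]
      abel

end Generators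

theorem Lst_weaklyPolymatroidal
    (n : ℕ) (nabla : Finset (Fin n) → Prop) (hco : IsCoComplex nabla)
    (hcover : ∀ i : Fin n, ∃ F G : Finset (Fin n), nabla F ∧ nabla G ∧
      F ∪ G = Finset.univ ∧ F ∩ G = {i})
    (s t : ℕ) (hs : 1 ≤ s) (ht : 1 ≤ t) (hts : 2 * t ≤ s) :
    WeaklyPolymatroidalWrt K xyOrder (Lst K n nabla s t) := by
  intro a b ha hb q hq hlt
  rw [isMonoMinGen_Lst_iff K hts] at ha hb
  have hsum_a := inl_add_inr_of_mem_lstExps hts ha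
  have hsum_b := inl_add_inr_of_mem_lstExps hts hb
  rcases q with i | i
  · have hai := hsum_a i
    have hbi := hsum_b i
    obtain ⟨d, hd, heq⟩ := exists_exchange_of_mem_lstExps hco hcover hts ha (i := i) (by omega)
    refine ⟨Sum.inr i, trivial, by omega, ?_⟩
    rw [isMonoMinGen_Lst_iff K hts, ← heq, add_tsub_cancel_right]
    exact hd
  · have hai := hsum_a i
    have hbi := hsum_b i
    have := hq (Sum.inl i) trivial
    omega

end Stmt
end
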